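/- arXiv:2404.15950 — 4 statements merged into one kernel-verified Lean document; each statement's English description precedes it below -/
import Mathlib

section
/- There is a universal constant c > 0 such that the following holds. Let I be a GCMP instance with k robots that admits at least one schedule, and suppose that every starting vertex s_i and every destination vertex t_i (for R_i ∈ M) is at distance at most 11k from a nice vertex of G. Then I admits a schedule of total traveled length at most Σ_{R_i ∈ M} dist_G(s_i, t_i) + c·k⁵. -/
open SimpleGraph

/-- A GCMP instance on a graph `G` with `k` robots: `isM i` holds iff robot `i` belongs
to the set `M` of robots with destinations (otherwise it is a free robot of `F`);
`start` gives the starting vertices (pairwise distinct), and `dest` gives the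
destination vertices of the robots in `M` (pairwise distinct on `M`). -/
structure Inst (V : Type) (G : SimpleGraph V) (k : ℕ) where
  isM : Fin k → Prop
  start : Fin k → V
  dest : Fin k → V
  start_inj : Function.Injective start
  dest_injOn : Set.InjOn dest {i | isM i}

/-- A schedule for a GCMP instance: positions `pos j i` of robot `i` at time `j ∈ [0,T]`,
each robot follows a route (stay or move along an edge), starting at its starting vertex,
robots of `M` ending at their destinations, and the routes are pairwise non-conflicting
(no two robots on the same vertex at the same time, and no edge swap). -/
structure Sched {V : Type} {G : SimpleGraph V} {k : ℕ} (I : Inst V G k) where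
  T : ℕ
  pos : ℕ → Fin k → V
  init : ∀ i, pos 0 i = I.start i
  final : ∀ i, I.isM i → pos T i = I.dest i
  step : ∀ j, j < T → ∀ i, pos (j + 1) i = pos j i ∨ G.Adj (pos j i) (pos (j + 1) i)
  noVertexConflict : ∀ j, j ≤ T → Function.Injective fun i => pos j i
  noSwap : ∀ j, j < T → ∀ i i', i ≠ i' →
      ¬(pos (j + 1) i = pos j i' ∧ pos (j + 1) i' = pos j i)

/-- The (traveled) length of the route of robot `i` in schedule `S`:
the number of time steps at which robot `i` moves. -/
noncomputable def routeLength {V : Type} {G : SimpleGraph V} {k : ℕ} {I : Inst V G k}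
    (S : Sched I) (i : Fin k) : ℕ :=
  {j : ℕ | j < S.T ∧ S.pos j i ≠ S.pos (j + 1) i}.ncard

/-- The total traveled length (energy) of a schedule. -/
noncomputable def totalLength {V : Type} {G : SimpleGraph V} {k : ℕ} {I : Inst V G k}
    (S : Sched I) : ℕ :=
  ∑ i : Fin k, routeLength S i

/-- A schedule is optimal if it has minimum total traveled length. -/
def Optimal {V : Type} {G : SimpleGraph V} {k : ℕ} {I : Inst V G k}
    (S : Sched I) : Prop :=
  ∀ S' : Sched I, totalLength S ≤ totalLength S'

/-- A vertex `w` of `G` is *nice* with respect to `k` if there are three connected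
subgraphs `C1, C2, C3` of `G` whose vertex sets pairwise intersect exactly in `{w}`,
with `|V(C1)| ≥ k+1`, `|V(C2)| ≥ k+1` and `|V(C3)| ≥ 2`. -/
def IsNice {V : Type} (G : SimpleGraph V) (k : ℕ) (w : V) : Prop :=
  ∃ C1 C2 C3 : G.Subgraph,
    C1.Connected ∧ C2.Connected ∧ C3.Connected ∧
    C1.verts ∩ C2.verts = {w} ∧ C1.verts ∩ C3.verts = {w} ∧ C2.verts ∩ C3.verts = {w} ∧
    k + 1 ≤ C1.verts.ncard ∧ k + 1 ≤ C2.verts.ncard ∧ 2 ≤ C3.verts.ncard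

/-- `H` is the haven of the nice vertex `w` built from the witnessing connected subgraphs
`C1, C2, C3` and a neighbor `x` of `w` lying in `C3`: it consists of those vertices of
`{x} ∪ V(C1) ∪ V(C2)` whose distance from `w` within (the subgraph induced by)
`{x} ∪ V(C1) ∪ V(C2)` is at most `k`. -/
def IsHavenWith {V : Type} (G : SimpleGraph V) (k : ℕ) (w : V)
    (C1 C2 C3 : G.Subgraph) (x : V) (H : Set V) : Prop :=
  C1.Connected ∧ C2.Connected ∧ C3.Connected ∧
  C1.verts ∩ C2.verts = {w} ∧ C1.verts ∩ C3.verts = {w} ∧ C2.verts ∩ C3.verts = {w} ∧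
  k + 1 ≤ C1.verts.ncard ∧ k + 1 ≤ C2.verts.ncard ∧ 2 ≤ C3.verts.ncard ∧
  x ∈ C3.verts ∧ G.Adj w x ∧
  ∃ hw : w ∈ ({x} ∪ C1.verts ∪ C2.verts : Set V),
    H = {u : V | ∃ hu : u ∈ ({x} ∪ C1.verts ∪ C2.verts : Set V),
          (G.induce ({x} ∪ C1.verts ∪ C2.verts : Set V)).dist ⟨w, hw⟩ ⟨u, hu⟩ ≤ k}

/-- `H` is a haven for `w` (for some choice of witnesses). -/
def IsHaven {V : Type} (G : SimpleGraph V) (k : ℕ) (w : V) (H : Set V) : Prop :=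
  ∃ (C1 C2 C3 : G.Subgraph) (x : V), IsHavenWith G k w C1 C2 C3 x H

namespace NN

variable {V : Type} {G : SimpleGraph V} {k : ℕ}

/-- A single robot moves to an adjacent empty vertex. -/
def Step (G : SimpleGraph V) (c d : Fin k → V) : Prop :=
  Function.Injective c ∧ ∃ i v, G.Adj (c i) v ∧ v ∉ Set.range c ∧ d = Function.update c i v

/-- Reachability of configurations with at most `n` single moves. -/
inductive Reach (G : SimpleGraph V) : ℕ → (Fin k → V) → (Fin k → V) → Prop
  | refl (n : ℕ) (c : Fin k → V) : Reach G n c c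
  | cons {n : ℕ} {c d e : Fin k → V} : Step G c d → Reach G n d e → Reach G (n + 1) c e

lemma inj_update {c : Fin k → V} (hc : Function.Injective c) {i : Fin k} {v : V}
    (hv : v ∉ Set.range c) : Function.Injective (Function.update c i v) := by
  intro a b hab
  by_cases ha : a = i <;> by_cases hb : b = i
  · rw [ha, hb]
  · subst ha
    rw [Function.update_self, Function.update_of_ne hb] at hab
    exact absurd ⟨b, hab.symm⟩ hv
  · subst hb
    rw [Function.update_self, Function.update_of_ne ha] at hab
    exact absurd ⟨a, hab⟩ hv
  · rw [Function.update_of_ne ha, Function.update_of_ne hb] at hab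
    exact hc hab

lemma Step.inj {c d : Fin k → V} (h : Step G c d) : Function.Injective d := by
  obtain ⟨hc, i, v, -, hv, rfl⟩ := h
  exact inj_update hc hv

lemma Step.symm {c d : Fin k → V} (h : Step G c d) : Step G d c := by
  have hd := h.inj
  obtain ⟨hc, i, v, ha, hv, rfl⟩ := h
  refine ⟨hd, i, c i, ?_, ?_, ?_⟩
  · simpa using ha.symm
  · rintro ⟨j, hj⟩
    by_cases hji : j = i
    · subst hji
      rw [Function.update_self] at hj
      exact hv ⟨_, hj.symm⟩
    · rw [Function.update_of_ne hji] at hj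
      exact hji (hc hj)
  · simp

lemma Step.perm {c d : Fin k → V} (h : Step G c d) (σ : Equiv.Perm (Fin k)) :
    Step G (c ∘ σ) (d ∘ σ) := by
  obtain ⟨hc, i, v, ha, hv, rfl⟩ := h
  refine ⟨hc.comp σ.injective, σ.symm i, v, by simpa using ha, ?_, ?_⟩
  · rintro ⟨j, hj⟩
    exact hv ⟨_, hj⟩
  · funext j
    by_cases h : σ j = i
    · have : j = σ.symm i := by simp [← h]
      subst this
      simp
    · have : j ≠ σ.symm i := by
        rintro rfl
        simp at h
      simp [Function.update_of_ne h, Function.update_of_ne this]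

lemma Reach.mono {n m : ℕ} {c d : Fin k → V} (h : Reach G n c d) (hnm : n ≤ m) :
    Reach G m c d := by
  induction h generalizing m with
  | refl n c => exact Reach.refl _ _
  | cons h1 h2 ih =>
    obtain ⟨m, rfl⟩ : ∃ m', m = m' + 1 := ⟨m - 1, by omega⟩
    exact Reach.cons h1 (ih (by omega))

lemma Reach.trans {n m : ℕ} {c d e : Fin k → V} (h : Reach G n c d) (h' : Reach G m d e) :
    Reach G (n + m) c e := by
  induction h with
  | refl n c => exact h'.mono (by omega)
  | cons h1 h2 ih => exact (Reach.cons h1 (ih h')).mono (by omega)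

lemma Reach.single {c d : Fin k → V} (h : Step G c d) : Reach G 1 c d :=
  Reach.cons h (Reach.refl 0 _)

lemma Reach.symm {n : ℕ} {c d : Fin k → V} (h : Reach G n c d) : Reach G n d c := by
  induction h with
  | refl n c => exact Reach.refl _ _
  | cons h1 h2 ih => exact ih.trans (Reach.single h1.symm)

lemma Reach.perm {n : ℕ} {c d : Fin k → V} (h : Reach G n c d) (σ : Equiv.Perm (Fin k)) :
    Reach G n (c ∘ σ) (d ∘ σ) := by
  induction h with
  | refl n c => exact Reach.refl _ _
  | cons h1 h2 ih => exact Reach.cons (h1.perm σ) ih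

lemma Reach.inj {n : ℕ} {c d : Fin k → V} (h : Reach G n c d) (hc : Function.Injective c) :
    Function.Injective d := by
  induction h with
  | refl n c => exact hc
  | cons h1 h2 ih => exact ih h1.inj

/-- Robots `i` and `q` can be exchanged. -/
def Sw (G : SimpleGraph V) (n : ℕ) (c : Fin k → V) (i q : Fin k) : Prop :=
  Reach G n c (c ∘ Equiv.swap i q)

lemma Sw.symm {n : ℕ} {c : Fin k → V} {i q : Fin k} (h : Sw G n c i q) : Sw G n c q i := by
  unfold Sw at *
  rwa [Equiv.swap_comm]

lemma Sw.mono {n m : ℕ} {c : Fin k → V} {i q : Fin k} (h : Sw G n c i q) (hnm : n ≤ m) :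
    Sw G m c i q := Reach.mono h hnm

lemma Sw.conj {n m : ℕ} {c d : Fin k → V} {i q : Fin k} (h : Reach G m c d)
    (hs : Sw G n d i q) : Sw G (2 * m + n) c i q :=
  ((h.trans hs).trans (h.perm _).symm).mono (by omega)

/-- Configuration `c` with robots `i`, `q` placed at `x`, `y`. -/
def P (c : Fin k → V) (i q : Fin k) (x y : V) : Fin k → V :=
  Function.update (Function.update c i x) q y

/-- `f` is not occupied by robots other than `i`, `q`. -/
def Fr (c : Fin k → V) (i q : Fin k) (f : V) : Prop := ∀ j, j ≠ i → j ≠ q → c j ≠ f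

lemma Fr.of_range {c : Fin k → V} {i q : Fin k} {f : V} (h : f ∉ Set.range c) : Fr c i q f :=
  fun j _ _ e => h ⟨j, e⟩

lemma Fr.left {c : Fin k → V} (hc : Function.Injective c) {i q : Fin k} : Fr c i q (c i) :=
  fun _ h _ e => h (hc e)

lemma Fr.right {c : Fin k → V} (hc : Function.Injective c) {i q : Fin k} : Fr c i q (c q) :=
  fun _ _ h e => h (hc e)

lemma P_left {c : Fin k → V} {i q : Fin k} (h : i ≠ q) (x y : V) : P c i q x y i = x := by
  simp [P, Function.update_of_ne h]

lemma P_right {c : Fin k → V} {i q : Fin k} (x y : V) : P c i q x y q = y := by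
  simp [P]

lemma P_other {c : Fin k → V} {i q j : Fin k} (x y : V) (h : j ≠ i) (h' : j ≠ q) :
    P c i q x y j = c j := by
  simp [P, Function.update_of_ne h, Function.update_of_ne h']

lemma P_self (c : Fin k → V) (i q : Fin k) : P c i q (c i) (c q) = c := by
  simp [P]

lemma P_cases {c : Fin k → V} {i q : Fin k} (h : i ≠ q) (x y : V) (j : Fin k) :
    (j = i ∧ P c i q x y j = x) ∨ (j = q ∧ P c i q x y j = y) ∨
      (j ≠ i ∧ j ≠ q ∧ P c i q x y j = c j) := by
  by_cases h1 : j = i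
  · subst h1
    exact Or.inl ⟨rfl, P_left h _ _⟩
  · by_cases h2 : j = q
    · subst h2
      exact Or.inr (Or.inl ⟨rfl, P_right _ _⟩)
    · exact Or.inr (Or.inr ⟨h1, h2, P_other _ _ h1 h2⟩)

lemma P_notin {c : Fin k → V} {i q : Fin k} (h : i ≠ q) {x y f : V} (hf : Fr c i q f)
    (hx : f ≠ x) (hy : f ≠ y) : f ∉ Set.range (P c i q x y) := by
  rintro ⟨j, hj⟩
  rcases P_cases (c := c) h x y j with ⟨_, e⟩ | ⟨_, e⟩ | ⟨h1, h2, e⟩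
  · exact hx (hj ▸ e)
  · exact hy (hj ▸ e)
  · exact hf j h1 h2 (e ▸ hj)

lemma P_inj {c : Fin k → V} (hc : Function.Injective c) {i q : Fin k} (h : i ≠ q) {x y : V}
    (hx : Fr c i q x) (hy : Fr c i q y) (hxy : x ≠ y) : Function.Injective (P c i q x y) := by
  intro a b hab
  rcases P_cases (c := c) h x y a with ⟨r, e⟩ | ⟨r, e⟩ | ⟨h1, h2, e⟩ <;>
  rcases P_cases (c := c) h x y b with ⟨r', e'⟩ | ⟨r', e'⟩ | ⟨h1', h2', e'⟩ <;>
  rw [e, e'] at hab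
  · rw [r, r']
  · exact absurd hab hxy
  · exact absurd hab.symm (hx _ h1' h2')
  · exact absurd hab.symm hxy
  · rw [r, r']
  · exact absurd hab.symm (hy _ h1' h2')
  · exact absurd hab (hx _ h1 h2)
  · exact absurd hab (hy _ h1 h2)
  · exact hc hab

lemma P_moveL {c : Fin k → V} (hc : Function.Injective c) {i q : Fin k} (h : i ≠ q) {x y x' : V}
    (hx : Fr c i q x) (hy : Fr c i q y) (hx' : Fr c i q x') (hxy : x ≠ y) (hxy' : x' ≠ y)
    (ha : G.Adj x x') : Reach G 1 (P c i q x y) (P c i q x' y) := by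
  apply Reach.single
  refine ⟨P_inj hc h hx hy hxy, i, x', by rwa [P_left h], P_notin h hx' ha.ne' hxy', ?_⟩
  unfold P
  rw [Function.update_comm h.symm, Function.update_idem, Function.update_comm h]

lemma P_moveR {c : Fin k → V} (hc : Function.Injective c) {i q : Fin k} (h : i ≠ q) {x y y' : V}
    (hx : Fr c i q x) (hy : Fr c i q y) (hy' : Fr c i q y') (hxy : x ≠ y) (hxy' : y' ≠ x)
    (ha : G.Adj y y') : Reach G 1 (P c i q x y) (P c i q x y') := by
  apply Reach.single
  refine ⟨P_inj hc h hx hy hxy, q, y', by rwa [P_right], P_notin h hy' hxy' ha.ne', ?_⟩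
  unfold P
  rw [Function.update_idem]

lemma P_swap {c : Fin k → V} {i q : Fin k} (h : i ≠ q) :
    P c i q (c q) (c i) = c ∘ Equiv.swap i q := by
  funext j
  rcases P_cases (c := c) h (c q) (c i) j with ⟨r, e⟩ | ⟨r, e⟩ | ⟨h1, h2, e⟩ <;> rw [e]
  · simp [r]
  · simp [r]
  · simp [Equiv.swap_apply_of_ne_of_ne h1 h2]

lemma star {c : Fin k → V} (hc : Function.Injective c) {i q : Fin k} (h : i ≠ q) {b y : V}
    (hb : b ∉ Set.range c) (hy : y ∉ Set.range c) (hby : b ≠ y) (ha : G.Adj (c i) (c q))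
    (hab : G.Adj (c i) b) (hay : G.Adj (c i) y) : Sw G 6 c i q := by
  have fb : Fr c i q b := Fr.of_range hb
  have fy : Fr c i q y := Fr.of_range hy
  have fi : Fr c i q (c i) := Fr.left hc
  have fq : Fr c i q (c q) := Fr.right hc
  have nb : ∀ j, b ≠ c j := fun j e => hb ⟨j, e.symm⟩
  have ny : ∀ j, y ≠ c j := fun j e => hy ⟨j, e.symm⟩
  have s1 : Reach G 1 (P c i q (c i) (c q)) (P c i q b (c q)) :=
    P_moveL hc h fi fq fb ha.ne (nb _) hab
  have s2 : Reach G 1 (P c i q b (c q)) (P c i q b (c i)) :=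
    P_moveR hc h fb fq fi (nb _) (nb _).symm ha.symm
  have s3 : Reach G 1 (P c i q b (c i)) (P c i q b y) :=
    P_moveR hc h fb fi fy (nb _) hby.symm hay
  have s4 : Reach G 1 (P c i q b y) (P c i q (c i) y) :=
    P_moveL hc h fb fy fi hby (ny _).symm hab.symm
  have s5 : Reach G 1 (P c i q (c i) y) (P c i q (c q) y) :=
    P_moveL hc h fi fy fq (ny _).symm (ny _).symm ha
  have s6 : Reach G 1 (P c i q (c q) y) (P c i q (c q) (c i)) :=
    P_moveR hc h fq fy fi (ny _).symm ha.ne hay.symm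
  have := ((((s1.trans s2).trans s3).trans s4).trans s5).trans s6
  rw [P_self, P_swap h] at this
  exact this

lemma vacate {c : Fin k → V} (hc : Function.Injective c) {p z : V} (W : G.Walk p z)
    (hW : W.IsPath) (hz : z ∉ Set.range c) : ∃ d : Fin k → V,
      Reach G (Set.ncard {j | c j ∈ W.support}) c d ∧ p ∉ Set.range d ∧
      (∀ j, c j ∉ W.support → d j = c j) ∧ (∀ j, c j ∈ W.support → d j ∈ W.support) := by
  induction W with
  | nil => exact ⟨c, Reach.refl _ _, hz, fun _ _ => rfl, fun _ h => h⟩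
  | @cons p p' z hadj W ih =>
    rw [SimpleGraph.Walk.cons_isPath_iff] at hW
    obtain ⟨d, h1, h2, h3, h4⟩ := ih hW.1 hz
    by_cases hp : p ∈ Set.range c
    · obtain ⟨r, hr⟩ := hp
      have hdr : d r = p := by rw [h3 r (by rw [hr]; exact hW.2), hr]
      have hd := h1.inj hc
      refine ⟨Function.update d r p', ?_, ?_, ?_, ?_⟩
      · have hst : Reach G 1 d (Function.update d r p') :=
          Reach.single ⟨hd, r, p', by rwa [hdr], h2, rfl⟩
        refine (h1.trans hst).mono ?_
        rw [← Set.ncard_insert_of_notMem (a := r) (by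
          simp only [Set.mem_ofPred_eq, hr]; exact hW.2) (Set.toFinite _)]
        apply Set.ncard_le_ncard _ (Set.toFinite _)
        intro j hj
        rcases hj with rfl | hj
        · simp [hr]
        · simp only [Set.mem_ofPred_eq] at hj
          simp [hj]
      · rintro ⟨j, hj⟩
        by_cases hjr : j = r
        · subst hjr
          rw [Function.update_self] at hj
          exact hadj.ne' hj
        · rw [Function.update_of_ne hjr] at hj
          exact hjr (hd (hj.trans hdr.symm))
      · intro j hj
        simp only [SimpleGraph.Walk.support_cons, List.mem_cons, not_or] at hj
        have : j ≠ r := by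
          rintro rfl
          exact hj.1 hr
        rw [Function.update_of_ne this, h3 j hj.2]
      · intro j hj
        simp only [SimpleGraph.Walk.support_cons, List.mem_cons] at hj ⊢
        by_cases hjr : j = r
        · subst hjr
          rw [Function.update_self]
          right
          exact W.start_mem_support
        · rw [Function.update_of_ne hjr]
          rcases hj with hj | hj
          · exact absurd (hc (hj.trans hr.symm)) hjr
          · exact Or.inr (h4 j hj)
    · exact ⟨c, Reach.refl _ _, hp, fun _ _ => rfl, fun _ h => h⟩

lemma vac {c : Fin k → V} (hc : Function.Injective c) {p z : V} (X : Set V) (W : G.Walk p z)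
    (hW : ∀ y ∈ W.support, y ∈ X) (hz : z ∉ Set.range c) : ∃ d : Fin k → V,
      Reach G k c d ∧ p ∉ Set.range d ∧
      (∀ j, c j ∉ X → d j = c j) ∧ (∀ y, y ∉ X → y ∉ Set.range c → y ∉ Set.range d) := by
  classical
  obtain ⟨d, h1, h2, h3, h4⟩ := vacate hc W.bypass W.bypass_isPath hz
  have hs : ∀ y ∈ W.bypass.support, y ∈ X := fun y hy => hW y (W.support_bypass_subset_support hy)
  refine ⟨d, h1.mono ?_, h2, fun j hj => h3 j fun hh => hj (hs _ hh), ?_⟩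
  · refine (Set.ncard_le_ncard (Set.subset_univ _) (Set.toFinite _)).trans ?_
    simp [Set.ncard_univ]
  · rintro y hy hyc ⟨j, hj⟩
    by_cases hjs : c j ∈ W.bypass.support
    · exact hy (hj ▸ hs _ (h4 j hjs))
    · exact hyc ⟨j, by rw [← h3 j hjs, hj]⟩

/-- Rooted connected set. -/
def RC (G : SimpleGraph V) (w : V) (S : Set V) : Prop :=
  w ∈ S ∧ ∀ x ∈ S, ∃ p : G.Walk w x, ∀ y ∈ p.support, y ∈ S

lemma exists_hole (c : Fin k → V) {S : Set V} (hS : k + 1 ≤ S.ncard) :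
    ∃ z ∈ S, z ∉ Set.range c := by
  by_contra! hcon
  have h1 : S.ncard ≤ (Set.range c).ncard := Set.ncard_le_ncard hcon (Set.toFinite _)
  have h2 : (Set.range c).ncard ≤ k := by
    rw [← Set.image_univ]
    exact (Set.ncard_image_le (Set.toFinite _)).trans (by simp [Set.ncard_univ])
  omega

lemma exists_hole' (c : Fin k → V) {S : Set V} {w : V} (hS : k + 1 ≤ S.ncard) (hw : w ∈ S)
    {i : Fin k} (hi : c i ∈ S → c i = w) : ∃ z ∈ S, z ≠ w ∧ z ∉ Set.range c := by
  have hfin : S.Finite := Set.finite_of_ncard_pos (by omega)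
  by_contra! hcon
  have h1 : (S \ {w}).ncard ≤ (c '' {j | j ≠ i}).ncard := by
    apply Set.ncard_le_ncard _ (Set.toFinite _)
    rintro z ⟨hz, hzw⟩
    obtain ⟨j, rfl⟩ := hcon z hz hzw
    refine ⟨j, ?_, rfl⟩
    rintro rfl
    exact hzw (hi hz)
  have h2 : (c '' {j | j ≠ i}).ncard ≤ k - 1 := by
    refine (Set.ncard_image_le (Set.toFinite _)).trans ?_
    have : {j | j ≠ i} = (Set.univ : Set (Fin k)) \ {i} := by ext; simp
    rw [this, Set.ncard_sdiff_singleton_of_mem (Set.mem_univ _)]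
    simp [Set.ncard_univ]
  have h3 := Set.ncard_sdiff_singleton_of_mem hw
  have := i.pos
  omega

lemma path_tail {S : Set V} {w z : V} (p : G.Walk w z) (hp : p.IsPath)
    (hS : ∀ y ∈ p.support, y ∈ S) (hz : z ≠ w) :
    ∃ b, G.Adj w b ∧ ∃ q : G.Walk b z, (∀ y ∈ q.support, y ∈ S ∧ y ≠ w) ∧
      q.support ⊆ p.support := by
  cases p with
  | nil => exact absurd rfl hz
  | @cons _ b _ h q =>
    rw [SimpleGraph.Walk.cons_isPath_iff] at hp
    refine ⟨b, h, q, fun y hy => ⟨hS y (by simp [hy]), ?_⟩, by simp⟩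
    rintro rfl
    exact hp.2 hy

lemma RC.path {w : V} {S : Set V} (h : RC G w S) {x : V} (hx : x ∈ S) :
    ∃ p : G.Walk w x, p.IsPath ∧ ∀ y ∈ p.support, y ∈ S := by
  classical
  obtain ⟨p, hp⟩ := h.2 x hx
  exact ⟨p.bypass, p.bypass_isPath, fun y hy => hp y (p.support_bypass_subset_support hy)⟩

lemma vacB {c : Fin k → V} (hc : Function.Injective c) {w z : V} {B : Set V} (hB : RC G w B)
    (hz : z ∈ B) (hzw : z ≠ w) (hzc : z ∉ Set.range c) : ∃ b, G.Adj w b ∧ b ∈ B ∧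
      ∃ d : Fin k → V, Reach G k c d ∧ b ∉ Set.range d ∧
      (∀ j, c j ∉ B \ {w} → d j = c j) ∧
      (∀ y, y ∉ B \ {w} → y ∉ Set.range c → y ∉ Set.range d) := by
  obtain ⟨p, hp, hpB⟩ := hB.path hz
  obtain ⟨b, hb, q, hq, -⟩ := path_tail p hp hpB hzw
  obtain ⟨d, h1, h2, h3, h4⟩ := vac hc (B \ {w}) q (fun y hy => hq y hy) hzc
  exact ⟨b, hb, (hq b q.start_mem_support).1, d, h1, h2, h3, h4⟩

lemma stageE {c : Fin k → V} (hc : Function.Injective c) {h t : Fin k} (hht : h ≠ t)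
    {w : V} {B : Set V} (hB : RC G w B) (hcard : k + 1 ≤ B.ncard)
    (haw : G.Adj (c h) w) (hat : G.Adj (c t) (c h)) (hhB : c h ∉ B) (htB : c t ∉ B)
    {y : V} (hwy : G.Adj w y) (hyB : y ∉ B) (hy : y ≠ c h) : Sw G (6 * k + 10) c h t := by
  -- clear y
  have s1 : ∃ c1 : Fin k → V, Reach G k c c1 ∧ c1 h = c h ∧ c1 t = c t ∧
      (y ∉ Set.range c1 ∨ y = c t) := by
    by_cases hyt : y = c t
    · exact ⟨c, Reach.refl _ _, rfl, rfl, Or.inr hyt⟩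
    · obtain ⟨z, hz, hzc⟩ := exists_hole c hcard
      obtain ⟨p, hp⟩ := hB.2 z hz
      obtain ⟨d, h1, h2, h3, h4⟩ := vac hc (insert y B) (SimpleGraph.Walk.cons hwy.symm p) (by
        intro x hx
        simp only [SimpleGraph.Walk.support_cons, List.mem_cons] at hx
        rcases hx with rfl | hx
        · exact Set.mem_insert _ _
        · exact Set.mem_insert_of_mem _ (hp x hx)) hzc
      refine ⟨d, h1, h3 h ?_, h3 t ?_, Or.inl h2⟩
      · rintro (e | e)
        · exact hy e.symm
        · exact hhB e
      · rintro (e | e)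
        · exact hyt e.symm
        · exact htB e
  obtain ⟨c1, r1, h1, t1, y1⟩ := s1
  have hc1 := r1.inj hc
  obtain ⟨z, hz, hzc⟩ := exists_hole c1 hcard
  obtain ⟨p, hp⟩ := hB.2 z hz
  obtain ⟨c2, r2, w2, o2, e2⟩ := vac hc1 B p hp hzc
  have hc2 := r2.inj hc1
  have h2 : c2 h = c h := by rw [o2 h (by rwa [h1]), h1]
  have t2 : c2 t = c t := by rw [o2 t (by rwa [t1]), t1]
  have y2 : y ∉ Set.range c2 ∨ y = c t := y1.imp (e2 y hyB) id
  obtain ⟨z2, hz2, hzw2, hzc2⟩ := exists_hole' c2 hcard hB.1 (i := h)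
    (by rw [h2]; exact fun e => absurd e hhB)
  obtain ⟨b, hwb, hbB, c3, r3, b3, o3, e3⟩ := vacB hc2 hB hz2 hzw2 hzc2
  have hc3 := r3.inj hc2
  have h3 : c3 h = c h := by rw [o3 h (by rw [h2]; exact fun e => hhB e.1), h2]
  have t3 : c3 t = c t := by rw [o3 t (by rw [t2]; exact fun e => htB e.1), t2]
  have y3 : y ∉ Set.range c3 ∨ y = c t := y2.imp (e3 y (fun e => hyB e.1)) id
  have w3 : w ∉ Set.range c3 := e3 w (fun e => e.2 rfl) w2
  have fw : Fr c3 h t w := Fr.of_range w3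
  have fb : Fr c3 h t b := Fr.of_range b3
  have fh : Fr c3 h t (c h) := h3 ▸ Fr.left hc3
  have ft : Fr c3 h t (c t) := t3 ▸ Fr.right hc3
  have fy : Fr c3 h t y := by
    rcases y3 with e | e
    · exact Fr.of_range e
    · exact e ▸ ft
  have wt : w ≠ c t := fun e => htB (e ▸ hB.1)
  have m1 : Reach G 1 (P c3 h t (c h) (c t)) (P c3 h t w (c t)) :=
    P_moveL hc3 hht fh ft fw hat.ne' wt haw
  have m2 : Reach G 1 (P c3 h t w (c t)) (P c3 h t w (c h)) :=
    P_moveR hc3 hht fw ft fh wt haw.ne hat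
  have hself : P c3 h t (c h) (c t) = c3 := by
    rw [← h3, ← t3]; exact P_self _ _ _
  rw [hself] at m1
  have tot := (((r1.trans r2).trans r3).trans m1).trans m2
  have hbh : b ≠ c h := fun e => hhB (e ▸ hbB)
  have hs := star (G := G) (P_inj hc3 hht fw fh haw.ne') hht (b := b) (y := y)
    (P_notin hht fb hwb.ne' hbh) (P_notin hht fy hwy.ne' hy) (fun e => hyB (e ▸ hbB))
    (by rw [P_left hht, P_right]; exact haw.symm) (by rwa [P_left hht]) (by rwa [P_left hht])
  exact (hs.conj tot).mono (by omega)

lemma snake {v w : V} (p : G.Walk v w) : ∀ (c : Fin k → V) (h t : Fin k) (B : Set V),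
    p.IsPath → Function.Injective c → h ≠ t → c h = v → G.Adj (c t) v → v ≠ w →
    (∀ y ∈ p.support, y ∈ B → y = w) → c t ∉ B → c t ∉ p.support →
    RC G w B → k + 1 ≤ B.ncard → (∀ a, ∃ y, G.Adj w y ∧ y ∉ B ∧ y ≠ a) →
    Sw G (2 * (k + 2) * p.length + (6 * k + 10)) c h t := by
  induction p with
  | nil => intro c h t B _ _ _ _ _ hv; exact absurd rfl hv
  | @cons v v1 w hadj p ih =>
    intro c h t B hp hc hht hch hadj' hvw hpB htB htp hB hcard hy
    have hvB : v ∉ B := fun e => hvw (hpB v (by simp) e)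
    by_cases hv1 : v1 = w
    · subst hv1
      obtain ⟨y, y1, y2, y3⟩ := hy v
      exact (stageE hc hht hB hcard (hch ▸ hadj) (hch ▸ hadj') (hch ▸ hvB) htB y1 y2
        (hch ▸ y3)).mono (by omega)
    · rw [SimpleGraph.Walk.cons_isPath_iff] at hp
      simp only [SimpleGraph.Walk.support_cons, List.mem_cons, not_or] at htp
      obtain ⟨z, hz, hzc⟩ := exists_hole c hcard
      obtain ⟨r, hr⟩ := hB.2 z hz
      obtain ⟨d, h1, h2, h3, h4⟩ := vac hc ({x | x ∈ p.support} ∪ B) (p.append r) (by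
        intro x hx
        rw [SimpleGraph.Walk.mem_support_append_iff] at hx
        exact hx.imp id (hr x)) hzc
      have hd := h1.inj hc
      have dh : d h = v := by
        rw [h3 h, hch]
        rw [hch]
        rintro (e | e)
        · exact hp.2 e
        · exact hvB e
      have dt : d t = c t := by
        apply h3 t
        rintro (e | e)
        · exact htp.2 e
        · exact htB e
      have f1 : Fr d h t v1 := Fr.of_range h2
      have fh : Fr d h t v := dh ▸ Fr.left hd
      have ft : Fr d h t (c t) := dt ▸ Fr.right hd
      have nt : v1 ≠ c t := by
        intro e
        exact h2 ⟨t, by rw [dt, e]⟩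
      have m1 : Reach G 1 (P d h t v (c t)) (P d h t v1 (c t)) :=
        P_moveL hd hht fh ft f1 hadj'.ne' nt hadj
      have m2 : Reach G 1 (P d h t v1 (c t)) (P d h t v1 v) :=
        P_moveR hd hht f1 ft fh nt hadj.ne hadj'
      have hself : P d h t v (c t) = d := by
        rw [← dh, ← dt]; exact P_self _ _ _
      rw [hself] at m1
      have tot := (h1.trans m1).trans m2
      have := ih (P d h t v1 v) h t B hp.1 (P_inj hd hht f1 fh hadj.ne') hht (P_left hht _ _)
        (by rwa [P_right]) hv1 (fun y hy => hpB y (by simp [hy])) (by rwa [P_right])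
        (by rw [P_right]; exact hp.2) hB hcard hy
      refine (this.conj tot).mono ?_
      rw [SimpleGraph.Walk.length_cons]
      ring_nf
      omega

/-- Data of a nice vertex. -/
structure ND (G : SimpleGraph V) (k : ℕ) (w : V) (A B : Set V) : Prop where
  rcA : RC G w A
  rcB : RC G w B
  inter : ∀ y ∈ A, y ∈ B → y = w
  cA : A.ncard = k + 1
  cB : B.ncard = k + 1
  ex : ∃ x, G.Adj w x ∧ x ∉ A ∧ x ∉ B

lemma ND.symm {w : V} {A B : Set V} (h : ND G k w A B) : ND G k w B A :=
  ⟨h.rcB, h.rcA, fun y a b => h.inter y b a, h.cB, h.cA, by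
    obtain ⟨x, a, b, c⟩ := h.ex
    exact ⟨x, a, c, b⟩⟩

lemma ND.third {w : V} {A B : Set V} (h : ND G k w A B) (hk : 0 < k) (a : V) :
    ∃ y, G.Adj w y ∧ y ∉ B ∧ y ≠ a := by
  obtain ⟨x, hx, hxA, hxB⟩ := h.ex
  by_cases hxa : x = a
  · obtain ⟨z, hz, hzw⟩ : ∃ z ∈ A, z ≠ w := by
      apply Set.exists_ne_of_one_lt_ncard
      have := h.cA
      omega
    obtain ⟨p, hp, hpA⟩ := h.rcA.path hz
    obtain ⟨b, hb, q, hq, -⟩ := path_tail p hp hpA hzw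
    obtain ⟨hbA, hbw⟩ := hq b q.start_mem_support
    refine ⟨b, hb, fun e => hbw (h.inter b hbA e), ?_⟩
    rintro rfl
    exact hxA (hxa ▸ hbA)
  · exact ⟨x, hx, hxB, hxa⟩

lemma gen {c : Fin k → V} (hc : Function.Injective c) {i q : Fin k} (hiq : i ≠ q)
    {w : V} {A B : Set V} (hN : ND G k w A B) (hadj : G.Adj (c i) (c q))
    (hi : c i ∉ B) (hq : c q ∉ B) (W : G.Walk (c q) w)
    (hW : ∀ y ∈ W.support, y ∈ B → y = w) {L : ℕ} (hL : W.length ≤ L) :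
    Sw G (2 * (k + 2) * L + (6 * k + 10)) c i q := by
  classical
  have hiw : c i ≠ w := fun e => hi (e ▸ hN.rcB.1)
  have hqw : c q ≠ w := fun e => hq (e ▸ hN.rcB.1)
  have hlen := W.length_bypass_le_length
  have hsub : ∀ y ∈ W.bypass.support, y ∈ B → y = w :=
    fun y hy => hW y (W.support_bypass_subset_support hy)
  by_cases hu : c i ∈ W.bypass.support
  · have h1 := snake (W.bypass.dropUntil (c i) hu) c i q B
      (W.bypass_isPath.dropUntil hu) hc hiq rfl hadj.symm hiw
      (fun y hy => hsub y (W.bypass.support_dropUntil_subset_support hu hy)) hq (by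
        intro hmem
        have hnd := W.bypass_isPath.support_nodup
        rw [← W.bypass.take_spec hu, SimpleGraph.Walk.support_append] at hnd
        have hdis := (List.nodup_append.1 hnd).2.2 (c q)
          (SimpleGraph.Walk.start_mem_support _) (c q)
        apply hdis _ rfl
        rw [SimpleGraph.Walk.mem_support_iff] at hmem
        rcases hmem with e | e
        · exact absurd e hadj.ne'
        · exact e) hN.rcB hN.cB.ge (hN.third i.pos)
    refine h1.mono ?_
    have := W.bypass.length_dropUntil_le_length hu
    gcongr
    omega
  · have h1 := snake W.bypass c q i B W.bypass_isPath hc hiq.symm rfl hadj hqw hsub hi hu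
      hN.rcB hN.cB.ge (hN.third i.pos)
    refine h1.symm.mono ?_
    gcongr
    omega

lemma RC.short {w : V} {S : Set V} (h : RC G w S) (hcard : S.ncard = k + 1) {x : V} (hx : x ∈ S) :
    ∃ p : G.Walk x w, p.length ≤ k ∧ ∀ y ∈ p.support, y ∈ S := by
  classical
  obtain ⟨p, hp, hpS⟩ := h.path hx
  refine ⟨p.reverse, ?_, by simpa using hpS⟩
  have hfin : S.Finite := Set.finite_of_ncard_pos (by omega)
  have h1 : p.support.toFinset.card = p.length + 1 := by
    rw [List.toFinset_card_of_nodup hp.support_nodup, SimpleGraph.Walk.length_support]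
  have h2 : (p.support.toFinset : Set V).ncard ≤ S.ncard :=
    Set.ncard_le_ncard (by intro y hy; exact hpS y (by simpa using hy)) hfin
  rw [Set.ncard_coe_finset] at h2
  simp only [SimpleGraph.Walk.length_reverse]
  omega

lemma nsA {c : Fin k → V} (hc : Function.Injective c) {i q : Fin k} (hiq : i ≠ q)
    {w : V} {A B : Set V} (hN : ND G k w A B) (hadj : G.Adj (c i) (c q))
    (hi : c i ∉ B) (hq : c q ∉ B) (hA : c i ∈ A ∨ c q ∈ A) :
    Sw G (2 * (k + 2) * k + (6 * k + 10)) c i q := by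
  have key : ∀ {i q : Fin k}, i ≠ q → G.Adj (c i) (c q) → c i ∉ B → c q ∉ B → c q ∈ A →
      Sw G (2 * (k + 2) * k + (6 * k + 10)) c i q := by
    intro i q hiq hadj hi hq hqA
    obtain ⟨p, hp, hpA⟩ := hN.rcA.short hN.cA hqA
    exact gen hc hiq hN hadj hi hq p (fun y hy => hN.inter y (hpA y hy)) hp
  rcases hA with h | h
  · exact (key hiq.symm hadj.symm hq hi h).symm
  · exact key hiq hadj hi hq h

lemma first_hit {S : Set V} {v w : V} (p : G.Walk v w) (hw : w ∈ S) :
    ∃ y ∈ S, ∃ r : G.Walk v y, r.length ≤ p.length ∧ ∀ z ∈ r.support, z ∈ S → z = y := by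
  induction p with
  | nil => exact ⟨_, hw, SimpleGraph.Walk.nil, by simp, by simp⟩
  | @cons v v1 w h p ih =>
    by_cases hv : v ∈ S
    · exact ⟨v, hv, SimpleGraph.Walk.nil, by simp, by simp⟩
    · obtain ⟨y, hy, r, hr, hr'⟩ := ih hw
      refine ⟨y, hy, SimpleGraph.Walk.cons h r, by simpa using hr, ?_⟩
      intro z hz hzS
      simp only [SimpleGraph.Walk.support_cons, List.mem_cons] at hz
      rcases hz with rfl | hz
      · exact absurd hzS hv
      · exact hr' z hz hzS

lemma nsO {c : Fin k → V} (hc : Function.Injective c) {i q : Fin k} (hiq : i ≠ q)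
    {w : V} {A B : Set V} (hN : ND G k w A B) (hadj : G.Adj (c i) (c q))
    (hi : c i ∉ B) (hq : c q ∉ B) (hiA : c i ∉ A) (hqA : c q ∉ A)
    {D : ℕ} (W : G.Walk (c q) w) (hW : W.length ≤ D) :
    Sw G (2 * (k + 2) * (D + k) + (6 * k + 10)) c i q := by
  have key : ∀ {A B : Set V}, ND G k w A B → c i ∉ B → c q ∉ B →
      (∃ y ∈ A, ∃ r : G.Walk (c q) y, r.length ≤ D ∧ ∀ z ∈ r.support, z ∈ A ∪ B → z = y) →
      Sw G (2 * (k + 2) * (D + k) + (6 * k + 10)) c i q := by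
    rintro A B hN hi hq ⟨y, hy, r, hr, hr'⟩
    obtain ⟨p, hp, hpA⟩ := hN.rcA.short hN.cA hy
    refine gen hc hiq hN hadj hi hq (r.append p) ?_ (by
      rw [SimpleGraph.Walk.length_append]; omega)
    intro z hz hzB
    rw [SimpleGraph.Walk.mem_support_append_iff] at hz
    rcases hz with hz | hz
    · have := hr' z hz (Or.inr hzB)
      subst this
      exact hN.inter _ hy hzB
    · exact hN.inter _ (hpA z hz) hzB
  obtain ⟨y, hy, r, hr, hr'⟩ := first_hit (S := A ∪ B) W (Or.inl hN.rcA.1)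
  rcases hy with hy | hy
  · exact key hN hi hq ⟨y, hy, r, hr.trans hW, hr'⟩
  · exact key hN.symm hiA hqA ⟨y, hy, r, hr.trans hW, by rwa [Set.union_comm]⟩

lemma wcase {c : Fin k → V} (hc : Function.Injective c) {i q : Fin k} (hiq : i ≠ q)
    {w : V} {A B : Set V} (hN : ND G k w A B) (hadj : G.Adj (c i) (c q))
    (hi : c i = w) (hq : c q ∉ B) :
    Sw G (2 * (k + 2) * (k + 1) + (6 * k + 10)) c i q := by
  classical
  have hqw : c q ≠ w := hi ▸ hadj.ne'
  obtain ⟨z, hzA, hzw, hzc⟩ := exists_hole' c hN.cA.ge hN.rcA.1 (i := i) (fun _ => hi)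
  obtain ⟨p, hp, hpA⟩ := hN.rcA.path hzA
  by_cases hv : c q ∈ p.support
  · have hdp := hp.dropUntil hv
    obtain ⟨r, hqr, s, hs, -⟩ := path_tail (S := A \ {w}) (p.dropUntil (c q) hv) hdp (by
      intro y hy
      refine ⟨hpA y (p.support_dropUntil_subset_support hv hy), ?_⟩
      rintro rfl
      have hnd := hp.support_nodup
      rw [← p.take_spec hv, SimpleGraph.Walk.support_append] at hnd
      have hdis := (List.nodup_append.1 hnd).2.2 y
          (SimpleGraph.Walk.start_mem_support _) y
      apply hdis _ rfl
      rw [SimpleGraph.Walk.mem_support_iff] at hy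
      rcases hy with e | e
      · exact absurd e.symm hqw
      · exact e) (fun e => hzc ⟨q, e.symm⟩)
    obtain ⟨d, r1, h2, h3, -⟩ := vac hc ((A \ {w}) \ {c q}) s (fun y hy => hs y hy) hzc
    have hd := r1.inj hc
    have di : d i = w := by
      rw [h3 i _, hi]
      rw [hi]
      exact fun e => e.1.2 rfl
    have dq : d q = c q := h3 q (fun e => e.2 rfl)
    obtain ⟨⟨hrA, hrw⟩, -⟩ := hs r s.start_mem_support
    have hrw : r ≠ w := hrw
    have fr : Fr d i q r := Fr.of_range h2
    have fi : Fr d i q w := di ▸ Fr.left hd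
    have fq : Fr d i q (c q) := dq ▸ Fr.right hd
    have m1 : Reach G 1 (P d i q w (c q)) (P d i q w r) :=
      P_moveR hd hiq fi fq fr hqw.symm hrw hqr
    have m2 : Reach G 1 (P d i q w r) (P d i q (c q) r) :=
      P_moveL hd hiq fi fr fq hrw.symm hqr.ne (hi ▸ hadj)
    have hself : P d i q w (c q) = d := by
      rw [← di, ← dq]; exact P_self _ _ _
    rw [hself] at m1
    have tot := (r1.trans m1).trans m2
    have := nsA (P_inj hd hiq fq fr hqr.ne) hiq hN (by rwa [P_left hiq, P_right])
      (by rwa [P_left hiq]) (by rw [P_right]; exact fun e => hrw (hN.inter r hrA e))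
      (by rw [P_right]; exact Or.inr hrA)
    refine (this.conj tot).mono ?_
    ring_nf
    omega
  · obtain ⟨y, hwy, s, hs, hsp⟩ := path_tail p hp hpA hzw
    obtain ⟨d, r1, h2, h3, h4⟩ := vac hc {x | x ∈ s.support} s (fun y hy => hy) hzc
    have hd := r1.inj hc
    have di : d i = w := by
      rw [h3 i _, hi]
      rw [hi]
      exact fun e => (hs w e).2 rfl
    have dq : d q = c q := h3 q (fun e => hv (hsp e))
    obtain ⟨z', hz', hzw', hzc'⟩ := exists_hole' d hN.cB.ge hN.rcB.1 (i := i) (fun _ => di)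
    obtain ⟨b, hwb, hbB, e, r2, be, e3, e4⟩ := vacB hd hN.rcB hz' hzw' hzc'
    have he := r2.inj hd
    have ei : e i = w := by
      rw [e3 i _, di]
      rw [di]
      exact fun h => h.2 rfl
    have eq : e q = c q := by
      rw [e3 q _, dq]
      rw [dq]
      exact fun h => hq h.1
    obtain ⟨hyA, hyw⟩ := hs y s.start_mem_support
    have hyB : y ∉ B := fun h => hyw (hN.inter y hyA h)
    have hye := e4 y (fun h => hyB h.1) h2
    have := star (G := G) he hiq be hye (fun h => hyB (h ▸ hbB)) (by rw [ei, eq, ← hi]; exact hadj)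
      (by rwa [ei]) (by rwa [ei])
    refine (this.conj (r1.trans r2)).mono ?_
    ring_nf
    omega

lemma straddle {c : Fin k → V} (hc : Function.Injective c) {i q : Fin k} (hiq : i ≠ q)
    {w : V} {A B : Set V} (hN : ND G k w A B) (hadj : G.Adj (c i) (c q))
    (hiw : c i ≠ w) (hqw : c q ≠ w) (hi : c i ∈ A) (hq : c q ∈ B) :
    Sw G (2 * (k + 2) * (k + 2) + (6 * k + 10)) c i q := by
  classical
  obtain ⟨z, hzA, hzc⟩ := exists_hole c hN.cA.ge
  obtain ⟨p1, hp1⟩ := hN.rcA.2 _ hi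
  obtain ⟨p2, hp2⟩ := hN.rcA.2 _ hzA
  have hiB : c i ∉ B := fun e => hiw (hN.inter _ hi e)
  have hqA : c q ∉ A := fun e => hqw (hN.inter _ e hq)
  obtain ⟨r, hir, s, hs, -⟩ := path_tail (S := A) (p1.reverse.append p2).bypass
    (SimpleGraph.Walk.bypass_isPath _) (by
      intro y hy
      have := SimpleGraph.Walk.support_bypass_subset_support _ hy
      rw [SimpleGraph.Walk.mem_support_append_iff] at this
      rcases this with h | h
      · exact hp1 y (by simpa using h)
      · exact hp2 y h) (fun e => hzc ⟨i, e.symm⟩)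
  obtain ⟨d, r1, h2, h3, -⟩ := vac hc (A \ {c i}) s (fun y hy => hs y hy) hzc
  have hd := r1.inj hc
  have di : d i = c i := h3 i (fun e => e.2 rfl)
  have dq : d q = c q := h3 q (fun e => hqA e.1)
  obtain ⟨hrA, -⟩ := hs r s.start_mem_support
  have hrq : r ≠ c q := fun e => hqA (e ▸ hrA)
  have fr : Fr d i q r := Fr.of_range h2
  have fi : Fr d i q (c i) := di ▸ Fr.left hd
  have fq : Fr d i q (c q) := dq ▸ Fr.right hd
  have m1 : Reach G 1 (P d i q (c i) (c q)) (P d i q r (c q)) :=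
    P_moveL hd hiq fi fq fr hadj.ne hrq hir
  have m2 : Reach G 1 (P d i q r (c q)) (P d i q r (c i)) :=
    P_moveR hd hiq fr fq fi hrq hir.ne hadj.symm
  have hself : P d i q (c i) (c q) = d := by
    rw [← di, ← dq]; exact P_self _ _ _
  rw [hself] at m1
  have tot := (r1.trans m1).trans m2
  have hPinj := P_inj hd hiq fr fi hir.ne'
  have hPadj : G.Adj (P d i q r (c i) i) (P d i q r (c i) q) := by
    rw [P_left hiq, P_right]; exact hir.symm
  have hPq : P d i q r (c i) q ∉ B := by rwa [P_right]
  have : Sw G (2 * (k + 2) * (k + 1) + (6 * k + 10)) (P d i q r (c i)) i q := by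
    by_cases hrw : r = w
    · exact wcase hPinj hiq hN hPadj (by rwa [P_left hiq]) hPq
    · refine (nsA hPinj hiq hN hPadj ?_ hPq ?_).mono (by gcongr; omega)
      · rw [P_left hiq]; exact fun e => hrw (hN.inter r hrA e)
      · rw [P_left hiq]; exact Or.inl hrA
  refine (this.conj tot).mono ?_
  ring_nf
  omega

lemma swap_main {c : Fin k → V} (hc : Function.Injective c) {i q : Fin k} (hiq : i ≠ q)
    {w : V} {A B : Set V} (hN : ND G k w A B) (hadj : G.Adj (c i) (c q))
    {D : ℕ} (W : G.Walk (c q) w) (hW : W.length ≤ D) :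
    Sw G (2 * (k + 2) * (D + k + 2) + (6 * k + 10)) c i q := by
  have b1 : 2 * (k + 2) * (k + 1) + (6 * k + 10) ≤ 2 * (k + 2) * (D + k + 2) + (6 * k + 10) := by
    exact Nat.add_le_add_right (Nat.mul_le_mul_left _ (by omega)) _
  have b2 : 2 * (k + 2) * (k + 2) + (6 * k + 10) ≤ 2 * (k + 2) * (D + k + 2) + (6 * k + 10) := by
    exact Nat.add_le_add_right (Nat.mul_le_mul_left _ (by omega)) _
  have b3 : 2 * (k + 2) * k + (6 * k + 10) ≤ 2 * (k + 2) * (D + k + 2) + (6 * k + 10) := by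
    exact Nat.add_le_add_right (Nat.mul_le_mul_left _ (by omega)) _
  have b4 : 2 * (k + 2) * (D + k) + (6 * k + 10) ≤ 2 * (k + 2) * (D + k + 2) + (6 * k + 10) := by
    exact Nat.add_le_add_right (Nat.mul_le_mul_left _ (by omega)) _
  have wc : ∀ {i q : Fin k}, i ≠ q → G.Adj (c i) (c q) → c i = w →
      Sw G (2 * (k + 2) * (D + k + 2) + (6 * k + 10)) c i q := by
    intro i q hiq hadj hi
    have hqw : c q ≠ w := hi ▸ hadj.ne'
    by_cases hq : c q ∈ B
    · exact (wcase hc hiq hN.symm hadj hi (fun e => hqw (hN.inter _ e hq))).mono b1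
    · exact (wcase hc hiq hN hadj hi hq).mono b1
  by_cases hiw : c i = w
  · exact wc hiq hadj hiw
  by_cases hqw : c q = w
  · exact (wc hiq.symm hadj.symm hqw).symm
  have nA : ∀ j, c j ≠ w → c j ∈ A → c j ∉ B := fun j h1 h2 h3 => h1 (hN.inter _ h2 h3)
  have nB : ∀ j, c j ≠ w → c j ∈ B → c j ∉ A := fun j h1 h2 h3 => h1 (hN.inter _ h3 h2)
  by_cases hiA : c i ∈ A
  · by_cases hqB : c q ∈ B
    · exact (straddle hc hiq hN hadj hiw hqw hiA hqB).mono b2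
    · exact (nsA hc hiq hN hadj (nA _ hiw hiA) hqB (Or.inl hiA)).mono b3
  · by_cases hiB : c i ∈ B
    · by_cases hqA : c q ∈ A
      · exact (straddle hc hiq hN.symm hadj hiw hqw hiB hqA).mono b2
      · exact (nsA hc hiq hN.symm hadj hiA hqA (Or.inl hiB)).mono b3
    · by_cases hqA : c q ∈ A
      · exact (nsA hc hiq hN hadj hiB (nA _ hqw hqA) (Or.inr hqA)).mono b3
      · by_cases hqB : c q ∈ B
        · exact (nsA hc hiq hN.symm hadj hiA hqA (Or.inr hqB)).mono b3
        · exact (nsO hc hiq hN hadj hiB hqB hiA hqA W hW).mono b4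

lemma rc_sub {C : G.Subgraph} (hC : C.Connected) {w : V} (hw : w ∈ C.verts) :
    RC G w C.verts := by
  refine ⟨hw, fun x hx => ?_⟩
  obtain ⟨p⟩ := hC.coe.preconnected ⟨w, hw⟩ ⟨x, hx⟩
  refine ⟨p.map C.hom, ?_⟩
  intro y hy
  have hy' : y ∈ p.support.map C.hom := by
    rw [← SimpleGraph.Walk.support_map]
    exact hy
  obtain ⟨z, -, rfl⟩ := List.mem_map.1 hy'
  exact z.2

lemma shrink {w : V} {C : Set V} (hC : RC G w C) : ∀ n : ℕ, n + 1 ≤ C.ncard →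
    ∃ S ⊆ C, RC G w S ∧ S.ncard = n + 1 := by
  intro n
  induction n with
  | zero =>
    intro _
    refine ⟨{w}, by simpa using hC.1, ⟨rfl, ?_⟩, by simp⟩
    rintro x rfl
    exact ⟨SimpleGraph.Walk.nil, by simp⟩
  | succ n ih =>
    intro hn
    obtain ⟨S, hSC, hS, hcard⟩ := ih (by omega)
    have hfin : S.Finite := Set.finite_of_ncard_pos (by omega)
    obtain ⟨y, hyC, hyS⟩ := Set.exists_mem_notMem_of_ncard_lt_ncard (s := S) (t := C) (by omega) hfin
    obtain ⟨p, hp⟩ := hC.2 y hyC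
    obtain ⟨e, he, h1, h2⟩ := p.exists_boundary_dart S hS.1 hyS
    refine ⟨insert e.snd S, ?_, ⟨Or.inr hS.1, ?_⟩, ?_⟩
    · rintro x (rfl | hx)
      · exact hp _ (p.dart_snd_mem_support_of_mem_darts he)
      · exact hSC hx
    · rintro x (rfl | hx)
      · obtain ⟨r, hr⟩ := hS.2 _ h1
        refine ⟨r.append (SimpleGraph.Walk.cons e.adj SimpleGraph.Walk.nil), ?_⟩
        intro z hz
        rw [SimpleGraph.Walk.mem_support_append_iff] at hz
        rcases hz with hz | hz
        · exact Or.inr (hr z hz)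
        · simp only [SimpleGraph.Walk.support_cons, SimpleGraph.Walk.support_nil, List.mem_cons,
            List.not_mem_nil, or_false] at hz
          rcases hz with rfl | rfl
          · exact Or.inr h1
          · exact Or.inl rfl
      · obtain ⟨r, hr⟩ := hS.2 x hx
        exact ⟨r, fun z hz => Or.inr (hr z hz)⟩
    · rw [Set.ncard_insert_of_notMem h2 hfin, hcard]

lemma nd_of_nice {w : V} (h : IsNice G k w) : ∃ A B, ND G k w A B := by
  obtain ⟨C1, C2, C3, c1, c2, c3, i12, i13, i23, n1, n2, n3⟩ := h
  have w12 : w ∈ C1.verts ∩ C2.verts := by rw [i12]; rfl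
  have w13 : w ∈ C1.verts ∩ C3.verts := by rw [i13]; rfl
  obtain ⟨A, hA, rA, nA⟩ := shrink (rc_sub c1 w12.1) k n1
  obtain ⟨B, hB, rB, nB⟩ := shrink (rc_sub c2 w12.2) k n2
  refine ⟨A, B, rA, rB, ?_, nA, nB, ?_⟩
  · intro y ya yb
    have : y ∈ C1.verts ∩ C2.verts := ⟨hA ya, hB yb⟩
    rw [i12] at this
    exact this
  · obtain ⟨z, hz, hzw⟩ : ∃ z ∈ C3.verts, z ≠ w := by
      apply Set.exists_ne_of_one_lt_ncard
      omega
    obtain ⟨p, hp, hpC⟩ := (rc_sub c3 w13.2).path hz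
    obtain ⟨x, hx, q, hq, -⟩ := path_tail p hp hpC hzw
    obtain ⟨hx3, hxw⟩ := hq x q.start_mem_support
    refine ⟨x, hx, fun e => hxw ?_, fun e => hxw ?_⟩
    · have : x ∈ C1.verts ∩ C3.verts := ⟨hA e, hx3⟩
      rw [i13] at this
      exact this
    · have : x ∈ C2.verts ∩ C3.verts := ⟨hB e, hx3⟩
      rw [i23] at this
      exact this

/-- `v` is within distance `D` of a nice vertex. -/
def Near (G : SimpleGraph V) (k : ℕ) (D : ℕ) (v : V) : Prop :=
  ∃ w A B, ND G k w A B ∧ ∃ W : G.Walk v w, W.length ≤ D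

/-- Cost of an exchange. -/
def SC (k D : ℕ) : ℕ := 2 * (k + 2) * (D + k + 2) + (6 * k + 10)

lemma move {D : ℕ} {u v : V} (p : G.Walk u v) : ∀ (c : Fin k → V) (i : Fin k), p.IsPath →
    Function.Injective c → c i = u → (∀ j, j ≠ i → c j ≠ v) →
    (∀ j, j ≠ i → c j ∈ p.support → Near G k D (c j)) →
    Reach G (p.length + (SC k D + 1) * Set.ncard {j | j ≠ i ∧ c j ∈ p.support}) c
      (Function.update c i v) := by
  induction p with
  | nil =>
    intro c i _ _ h _ _
    rw [← h, Function.update_eq_self]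
    exact Reach.refl _ _
  | @cons u u1 v hadj p ih =>
    intro c i hp hc hi hv hnear
    rw [SimpleGraph.Walk.cons_isPath_iff] at hp
    by_cases hu1 : u1 ∈ Set.range c
    · obtain ⟨q, hq⟩ := hu1
      have hqi : q ≠ i := by
        rintro rfl
        exact hadj.ne (hi.symm.trans hq)
      obtain ⟨w, A, B, hN, W, hW⟩ := hnear q hqi (by simp [hq])
      have hsw : Sw G (SC k D) c i q :=
        swap_main hc hqi.symm hN (by rw [hi, hq]; exact hadj) W hW
      have hc'inj : Function.Injective (c ∘ Equiv.swap i q) := hc.comp (Equiv.injective _)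
      have c'i : (c ∘ Equiv.swap i q) i = u1 := by simp [hq]
      have c'q : (c ∘ Equiv.swap i q) q = u := by simp [hi]
      have c'o : ∀ j, j ≠ i → j ≠ q → (c ∘ Equiv.swap i q) j = c j := by
        intro j h1 h2
        simp [Equiv.swap_apply_of_ne_of_ne h1 h2]
      unfold Sw at hsw
      generalize hc' : c ∘ Equiv.swap i q = c' at *
      have r2 := ih c' i hp.1 hc'inj c'i (by
        intro j hj
        by_cases hjq : j = q
        · subst hjq
          rw [c'q]
          rintro rfl
          exact hp.2 p.end_mem_support
        · rw [c'o j hj hjq]; exact hv j hj) (by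
        intro j hj hjp
        by_cases hjq : j = q
        · subst hjq
          rw [c'q] at hjp
          exact absurd hjp hp.2
        · rw [c'o j hj hjq] at hjp ⊢
          exact hnear j hj (by simp [hjp]))
      have hinj2 := r2.inj hc'inj
      have r3 : Reach G 1 (Function.update c' i v) (Function.update (Function.update c' i v) q u1) := by
        apply Reach.single
        refine ⟨hinj2, q, u1, ?_, ?_, rfl⟩
        · rw [Function.update_of_ne hqi, c'q]; exact hadj
        · rintro ⟨j, hj⟩
          by_cases hji : j = i
          · subst hji
            rw [Function.update_self] at hj
            exact hv q hqi (hq.trans hj.symm)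
          · rw [Function.update_of_ne hji] at hj
            by_cases hjq : j = q
            · subst hjq
              rw [c'q] at hj
              exact hadj.ne hj
            · rw [c'o j hji hjq] at hj
              exact hjq (hc (hj.trans hq.symm))
      have hfin : Function.update (Function.update c' i v) q u1 = Function.update c i v := by
        funext j
        by_cases hjq : j = q
        · subst hjq
          rw [Function.update_self, Function.update_of_ne hqi, hq]
        · rw [Function.update_of_ne hjq]
          by_cases hji : j = i
          · subst hji
            simp
          · rw [Function.update_of_ne hji, Function.update_of_ne hji, c'o j hji hjq]
      rw [hfin] at r3
      refine ((hsw.trans r2).trans r3).mono ?_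
      have hcount : Set.ncard {j | j ≠ i ∧ c' j ∈ p.support} + 1 ≤
          Set.ncard {j | j ≠ i ∧ c j ∈ (SimpleGraph.Walk.cons hadj p).support} := by
        rw [← Set.ncard_insert_of_notMem (a := q) (by
          rintro ⟨-, h⟩
          rw [c'q] at h
          exact hp.2 h) (Set.toFinite _)]
        apply Set.ncard_le_ncard _ (Set.toFinite _)
        rintro j (rfl | ⟨hj, hjp⟩)
        · exact ⟨hqi, by simp [hq]⟩
        · refine ⟨hj, ?_⟩
          by_cases hjq : j = q
          · subst hjq
            simp [hq]
          · rw [c'o j hj hjq] at hjp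
            simp [hjp]
      have := Nat.mul_le_mul_left (SC k D + 1) hcount
      rw [SimpleGraph.Walk.length_cons]
      rw [Nat.mul_add, Nat.mul_one] at this
      omega
    · have st : Reach G 1 c (Function.update c i u1) :=
        Reach.single ⟨hc, i, u1, hi ▸ hadj, hu1, rfl⟩
      have r2 := ih (Function.update c i u1) i hp.1 (st.inj hc) (by simp) (by
        intro j hj
        rw [Function.update_of_ne hj]
        exact hv j hj) (by
        intro j hj
        rw [Function.update_of_ne hj]
        exact fun h => hnear j hj (by simp [h]))
      rw [Function.update_idem] at r2
      refine (st.trans r2).mono ?_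
      have hcount : Set.ncard {j | j ≠ i ∧ Function.update c i u1 j ∈ p.support} ≤
          Set.ncard {j | j ≠ i ∧ c j ∈ (SimpleGraph.Walk.cons hadj p).support} := by
        apply Set.ncard_le_ncard _ (Set.toFinite _)
        rintro j ⟨hj, hjp⟩
        rw [Function.update_of_ne hj] at hjp
        exact ⟨hj, by simp [hjp]⟩
      have := Nat.mul_le_mul_left (SC k D + 1) hcount
      rw [SimpleGraph.Walk.length_cons]
      omega

lemma go {D L : ℕ} {c : Fin k → V} (hc : Function.Injective c) {i : Fin k} {v : V}
    (W : G.Walk (c i) v) (hL : W.length ≤ L) (hv : v ∉ Set.range c) (hnear : ∀ j, Near G k D (c j)) :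
    Reach G (L + (SC k D + 1) * k) c (Function.update c i v) := by
  classical
  refine (move W.bypass c i W.bypass_isPath hc rfl (fun j _ e => hv ⟨j, e⟩)
    (fun j _ _ => hnear j)).mono ?_
  have h1 := W.length_bypass_le_length
  have h2 : Set.ncard {j | j ≠ i ∧ c j ∈ W.bypass.support} ≤ k := by
    refine (Set.ncard_le_ncard (Set.subset_univ _) (Set.toFinite _)).trans ?_
    simp [Set.ncard_univ]
  have := Nat.mul_le_mul_left (SC k D + 1) h2
  omega

lemma range_card (c : Fin k → V) : (Set.range c).ncard ≤ k := by
  rw [← Set.image_univ]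
  exact (Set.ncard_image_le (Set.toFinite _)).trans (by simp [Set.ncard_univ])

lemma phase1 {s : Fin k → V} (hs : Function.Injective s) (hnear : ∀ i, Near G k (11 * k) (s i))
    (T : Set V) (hTf : T.Finite) (hT : T.ncard ≤ k) (F : Finset (Fin k)) :
    ∃ d : Fin k → V, Reach G (F.card * (12 * k + (SC k (11 * k) + 1) * k)) s d ∧
      (∀ i, i ∉ F → d i = s i) ∧
      (∀ i ∈ F, d i ∉ T ∧ Near G k (11 * k) (d i) ∧ ∃ W : G.Walk (s i) (d i), W.length ≤ 12 * k) := by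
  induction F using Finset.induction_on with
  | empty => exact ⟨s, Reach.refl _ _, fun _ _ => rfl, by simp⟩
  | insert i F hi ih =>
    obtain ⟨d, r1, h1, h2⟩ := ih
    have hd := r1.inj hs
    obtain ⟨w, A, B, hN, W, hW⟩ := hnear i
    have fA : A.Finite := Set.finite_of_ncard_pos (by have := hN.cA; omega)
    have fB : B.Finite := Set.finite_of_ncard_pos (by have := hN.cB; omega)
    have hAB : (A ∪ B).ncard = 2 * k + 1 := by
      have e1 := Set.ncard_union_add_ncard_inter A B fA fB
      have : A ∩ B = {w} := by
        ext y
        constructor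
        · rintro ⟨a, b⟩
          exact hN.inter y a b
        · rintro rfl
          exact ⟨hN.rcA.1, hN.rcB.1⟩
      rw [this, Set.ncard_singleton, hN.cA, hN.cB] at e1
      omega
    obtain ⟨m, hm, hmn⟩ := Set.exists_mem_notMem_of_ncard_lt_ncard
      (s := Set.range d ∪ T) (t := A ∪ B) (by
        have := Set.ncard_union_le (Set.range d) T
        have := range_card d
        omega) ((Set.toFinite _).union hTf)
    have hmd : m ∉ Set.range d := fun e => hmn (Or.inl e)
    have hmT : m ∉ T := fun e => hmn (Or.inr e)
    obtain ⟨Z, hZ⟩ : ∃ Z : G.Walk m w, Z.length ≤ k := by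
      rcases hm with hm | hm
      · obtain ⟨Z, hZ, -⟩ := hN.rcA.short hN.cA hm
        exact ⟨Z, hZ⟩
      · obtain ⟨Z, hZ, -⟩ := hN.rcB.short hN.cB hm
        exact ⟨Z, hZ⟩
    have hlen : (W.append Z.reverse).length ≤ 12 * k := by
      rw [SimpleGraph.Walk.length_append, SimpleGraph.Walk.length_reverse]
      omega
    have hdi : d i = s i := h1 i hi
    have hnd : ∀ j, Near G k (11 * k) (d j) := by
      intro j
      by_cases hj : j ∈ F
      · exact (h2 j hj).2.1
      · rw [h1 j hj]; exact hnear j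
    have r2 := go (D := 11 * k) (L := 12 * k) hd (i := i) ((W.append Z.reverse).copy hdi.symm rfl)
      (by simpa using hlen) hmd hnd
    refine ⟨Function.update d i m, (r1.trans r2).mono ?_, ?_, ?_⟩
    · rw [Finset.card_insert_of_notMem hi]
      exact le_of_eq (by ring)
    · intro j hj
      simp only [Finset.mem_insert, not_or] at hj
      rw [Function.update_of_ne hj.1, h1 j hj.2]
    · intro j hj
      by_cases hji : j = i
      · subst hji
        rw [Function.update_self]
        exact ⟨hmT, ⟨w, A, B, hN, Z, by omega⟩, _, hlen⟩
      · rw [Function.update_of_ne hji]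
        exact h2 j ((Finset.mem_insert.1 hj).resolve_left hji)

lemma phase2 {s t d : Fin k → V} (hd : Function.Injective d)
    (hnear : ∀ i, Near G k (11 * k) (d i))
    (hw : ∀ i, ∃ W : G.Walk (s i) (d i), W.length ≤ 12 * k)
    (M : Set (Fin k)) (hinj : Set.InjOn t M) (hdt : ∀ j, ∀ i ∈ M, d j ≠ t i)
    (hnt : ∀ i ∈ M, Near G k (11 * k) (t i)) (hr : ∀ i ∈ M, G.Reachable (s i) (t i))
    (F : Finset (Fin k)) (hF : ∀ i ∈ F, i ∈ M) :
    ∃ e : Fin k → V,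
      Reach G (∑ i ∈ F, (G.dist (s i) (t i) + 12 * k + (SC k (11 * k) + 1) * k)) d e ∧
      (∀ i, i ∉ F → e i = d i) ∧ (∀ i ∈ F, e i = t i) := by
  induction F using Finset.induction_on with
  | empty => exact ⟨d, Reach.refl _ _, fun _ _ => rfl, by simp⟩
  | insert i F hi ih =>
    obtain ⟨e, r1, h1, h2⟩ := ih (fun j hj => hF j (Finset.mem_insert_of_mem hj))
    have hiM := hF i (Finset.mem_insert_self _ _)
    have he := r1.inj hd
    obtain ⟨W, hW⟩ := hw i
    obtain ⟨Z, hZ⟩ := (hr i hiM).exists_walk_length_eq_dist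
    have hlen : (W.reverse.append Z).length ≤ G.dist (s i) (t i) + 12 * k := by
      rw [SimpleGraph.Walk.length_append, SimpleGraph.Walk.length_reverse]
      omega
    have hei : e i = d i := h1 i hi
    have hne : ∀ j, Near G k (11 * k) (e j) := by
      intro j
      by_cases hj : j ∈ F
      · rw [h2 j hj]; exact hnt j (hF j (Finset.mem_insert_of_mem hj))
      · rw [h1 j hj]; exact hnear j
    have hti : t i ∉ Set.range e := by
      rintro ⟨j, hj⟩
      by_cases hjF : j ∈ F
      · rw [h2 j hjF] at hj
        have := hinj (hF j (Finset.mem_insert_of_mem hjF)) hiM hj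
        exact hi (this ▸ hjF)
      · rw [h1 j hjF] at hj
        exact hdt j i hiM hj
    have r2 := go (D := 11 * k) (L := G.dist (s i) (t i) + 12 * k) he (i := i)
      ((W.reverse.append Z).copy hei.symm rfl) (by simpa using hlen) hti hne
    refine ⟨Function.update e i (t i), (r1.trans r2).mono ?_, ?_, ?_⟩
    · rw [Finset.sum_insert hi]
      omega
    · intro j hj
      simp only [Finset.mem_insert, not_or] at hj
      rw [Function.update_of_ne hj.1, h1 j hj.2]
    · intro j hj
      by_cases hji : j = i
      · subst hji
        rw [Function.update_self]
      · rw [Function.update_of_ne hji]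
        exact h2 j ((Finset.mem_insert.1 hj).resolve_left hji)

lemma Reach.seq {n : ℕ} {c d : Fin k → V} (h : Reach G n c d) : ∃ T ≤ n, ∃ pos : ℕ → Fin k → V,
    pos 0 = c ∧ pos T = d ∧ ∀ j < T, Step G (pos j) (pos (j + 1)) := by
  induction h with
  | refl n c => exact ⟨0, by omega, fun _ => c, rfl, rfl, by omega⟩
  | @cons n c d e h1 h2 ih =>
    obtain ⟨T, hT, pos, p0, pT, hst⟩ := ih
    refine ⟨T + 1, by omega, fun j => Nat.casesOn j c pos, rfl, pT, ?_⟩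
    intro j hj
    cases j with
    | zero => simpa [p0] using h1
    | succ j => exact hst j (by omega)

lemma sched_of_reach {I : Inst V G k} {n : ℕ} {d : Fin k → V} (h : Reach G n I.start d)
    (hd : ∀ i, I.isM i → d i = I.dest i) : ∃ S : Sched I, totalLength S ≤ n := by
  classical
  obtain ⟨T, hT, pos, p0, pT, hst⟩ := h.seq
  have hinj : ∀ j ≤ T, Function.Injective (pos j) := by
    intro j hj
    cases j with
    | zero => rw [p0]; exact I.start_inj
    | succ j => exact (hst j (by omega)).inj
  let S : Sched I :=
    { T := T
      pos := pos
      init := fun i => by rw [p0]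
      final := fun i hi => by rw [pT, hd i hi]
      step := by
        intro j hj i
        obtain ⟨-, r, v, ha, -, hu⟩ := hst j hj
        rw [hu]
        by_cases hir : i = r
        · subst hir
          right
          rw [Function.update_self]
          exact ha
        · left
          rw [Function.update_of_ne hir]
      noVertexConflict := fun j hj => hinj j hj
      noSwap := by
        rintro j hj i i' hii ⟨h1, h2⟩
        obtain ⟨hi, r, v, ha, hv, hu⟩ := hst j hj
        rw [hu] at h1 h2
        by_cases hir : i = r
        · subst hir
          rw [Function.update_self] at h1
          exact hv ⟨i', h1.symm⟩
        · rw [Function.update_of_ne hir] at h1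
          exact hii (hi h1) }
  refine ⟨S, le_trans ?_ hT⟩
  have hroute : ∀ i, routeLength S i =
      ∑ j ∈ Finset.range T, if pos j i ≠ pos (j + 1) i then 1 else 0 := by
    intro i
    rw [← Finset.card_filter, ← Set.ncard_coe_finset]
    unfold routeLength
    congr 1
    ext j
    simp [S]
  unfold totalLength
  simp_rw [hroute]
  rw [Finset.sum_comm]
  have : ∀ j ∈ Finset.range T, (∑ i, if pos j i ≠ pos (j + 1) i then 1 else 0) ≤ 1 := by
    intro j hj
    obtain ⟨-, r, v, -, -, hu⟩ := hst j (Finset.mem_range.1 hj)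
    rw [← Finset.card_filter]
    refine (Finset.card_le_card (t := {r}) ?_).trans (by simp)
    intro i hi
    rw [Finset.mem_filter] at hi
    by_contra hir
    rw [Finset.mem_singleton] at hir
    apply hi.2
    rw [hu, Function.update_of_ne hir]
  refine (Finset.sum_le_sum this).trans (by simp)

lemma near_of {v n : V} {D : ℕ} (hn : IsNice G k n) (hr : G.Reachable v n) (hd : G.dist v n ≤ D) :
    Near G k D v := by
  obtain ⟨A, B, hN⟩ := nd_of_nice hn
  obtain ⟨W, hW⟩ := hr.exists_walk_length_eq_dist
  exact ⟨n, A, B, hN, W, by omega⟩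

lemma sched_reachable {I : Inst V G k} (S : Sched I) (i : Fin k) (hi : I.isM i) :
    G.Reachable (I.start i) (I.dest i) := by
  have : ∀ j ≤ S.T, G.Reachable (I.start i) (S.pos j i) := by
    intro j
    induction j with
    | zero => intro _; rw [S.init]
    | succ j ih =>
      intro hj
      have h1 := ih (by omega)
      rcases S.step j (by omega) i with h | h
      · rwa [h]
      · exact h1.trans h.reachable
  have h := this S.T le_rfl
  rwa [S.final i hi] at h

lemma arith (k : ℕ) (hk : 0 < k) :
    k * (12 * k + (SC k (11 * k) + 1) * k) + k * (12 * k + (SC k (11 * k) + 1) * k) ≤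
      226 * k ^ 5 := by
  have h1 : SC k (11 * k) + 1 ≤ 101 * k ^ 2 := by
    unfold SC
    nlinarith
  have h2 : (SC k (11 * k) + 1) * k ≤ 101 * k ^ 2 * k := Nat.mul_le_mul_right k h1
  have h3 : k * k ≤ k ^ 5 := by
    rw [← pow_two]; exact Nat.pow_le_pow_right hk (by norm_num)
  have h4 : k ^ 4 ≤ k ^ 5 := Nat.pow_le_pow_right hk (by norm_num)
  have h5 : k * ((SC k (11 * k) + 1) * k) ≤ 101 * k ^ 4 :=
    (Nat.mul_le_mul_left k h2).trans (le_of_eq (by ring))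
  rw [Nat.mul_add]
  have h6 : k * (12 * k) = 12 * (k * k) := by ring
  omega

end NN

open Classical in
/-- There is a universal constant `c > 0` such that: every feasible
GCMP instance with `k` robots in which every starting vertex and every destination vertex
(of a robot in `M`) is at distance at most `11k` from a nice vertex admits a schedule of
total traveled length at most `Σ_{i ∈ M} dist(s_i, t_i) + c * k ^ 5`. -/
theorem near_nice_cheap_schedule :
    ∃ c : ℕ, 0 < c ∧
      ∀ (V : Type) (G : SimpleGraph V) (k : ℕ) (I : Inst V G k),
        Nonempty (Sched I) →
        (∀ i : Fin k, ∃ n : V, IsNice G k n ∧ G.Reachable (I.start i) n ∧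
          G.dist (I.start i) n ≤ 11 * k) →
        (∀ i : Fin k, I.isM i → ∃ n : V, IsNice G k n ∧ G.Reachable (I.dest i) n ∧
          G.dist (I.dest i) n ≤ 11 * k) →
        ∃ S : Sched I,
          totalLength S ≤
            (∑ i : Fin k, if I.isM i then G.dist (I.start i) (I.dest i) else 0)
              + c * k ^ 5 := by
  classical
  refine ⟨226, by norm_num, ?_⟩
  intro V G k I ⟨S0⟩ hs ht
  have hns : ∀ i, NN.Near G k (11 * k) (I.start i) := by
    intro i
    obtain ⟨n, h1, h2, h3⟩ := hs i
    exact NN.near_of h1 h2 h3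
  have hnt : ∀ i, I.isM i → NN.Near G k (11 * k) (I.dest i) := by
    intro i hi
    obtain ⟨n, h1, h2, h3⟩ := ht i hi
    exact NN.near_of h1 h2 h3
  obtain ⟨d, r1, -, h2⟩ := NN.phase1 I.start_inj hns (Set.range I.dest) (Set.toFinite _)
    (NN.range_card _) Finset.univ
  have hd := r1.inj I.start_inj
  obtain ⟨e, r2, -, h4⟩ := NN.phase2 (s := I.start) (t := I.dest) hd
    (fun i => (h2 i (Finset.mem_univ _)).2.1) (fun i => (h2 i (Finset.mem_univ _)).2.2)
    {i | I.isM i} I.dest_injOn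
    (fun j i _ hji => (h2 j (Finset.mem_univ _)).1 ⟨i, hji.symm⟩)
    (fun i hi => hnt i hi) (fun i hi => NN.sched_reachable S0 i hi)
    (Finset.univ.filter fun i => I.isM i) (fun i hi => (Finset.mem_filter.1 hi).2)
  obtain ⟨S, hS⟩ := NN.sched_of_reach (I := I) (r1.trans r2)
    (fun i hi => h4 i (by simp [hi]))
  refine ⟨S, hS.trans ?_⟩
  rcases Nat.eq_zero_or_pos k with rfl | hk
  · simp
  have ha := NN.arith k hk
  have hsum : ∑ i ∈ Finset.univ.filter (fun i => I.isM i),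
      (G.dist (I.start i) (I.dest i) + 12 * k + (NN.SC k (11 * k) + 1) * k) ≤
      (∑ i : Fin k, if I.isM i then G.dist (I.start i) (I.dest i) else 0) +
        k * (12 * k + (NN.SC k (11 * k) + 1) * k) := by
    rw [← Finset.sum_filter]
    simp_rw [add_assoc]
    rw [Finset.sum_add_distrib, Finset.sum_const, smul_eq_mul]
    gcongr
    exact (Finset.card_le_univ _).trans (by simp)
  rw [Finset.card_univ, Fintype.card_fin]
  omega
end

section
/- Let I be a GCMP instance with k robots and let (H,Z) be a p-boundaried subgraph of G whose boundary Z contains all terminals. There is a universal constant c > 0 such that if S is a schedule for I in which each vertex is entered by any robot at most ν(k) times, then the number of checkpoints of S with respect to (H,Z) is at most c·p·k·ν(k). -/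
open SimpleGraph

/-- `(H, Z)` is a `p`-boundaried subgraph of `G`: `H` is a set of vertices (inducing the
subgraph), `Z ⊆ H` is a finite boundary with `|Z| ≤ p`, and `Z` separates `H \ Z` from
the complement of `H` (no edge of `G` joins `H \ Z` to the outside of `H`). -/
def IsBoundaried {V : Type} (G : SimpleGraph V) (H Z : Set V) (p : ℕ) : Prop :=
  Z ⊆ H ∧ Z.Finite ∧ Z.ncard ≤ p ∧
  ∀ u w : V, u ∈ H → u ∉ Z → w ∉ H → ¬ G.Adj u w

/-- The status of a robot relative to a boundaried subgraph `(H, Z)`: located at a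
boundary vertex, strictly inside `H`, or outside `H` (`↑`). -/
inductive BStatus (V : Type) : Type where
  | atZ (v : V) : BStatus V
  | inside : BStatus V
  | outside : BStatus V

/-- Schedule `S` (internally or externally) affects `(H, Z)` at time steps `(j, j+1)`:
during time step `j+1` some robot moves between a vertex of `H` and a vertex of `Z`,
or between a vertex of `Z` and a vertex outside `H`. Such pairs `(j, j+1)` are the
checkpoints of `S` with respect to `(H, Z)`. -/
def SAffects {V : Type} {G : SimpleGraph V} {k : ℕ} {I : Inst V G k}
    (H Z : Set V) (S : Sched I) (j : ℕ) : Prop :=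
  ∃ i : Fin k, S.pos j i ≠ S.pos (j + 1) i ∧
    ((S.pos j i ∈ H ∧ S.pos (j + 1) i ∈ Z) ∨ (S.pos j i ∈ Z ∧ S.pos (j + 1) i ∈ H) ∨
     (S.pos j i ∉ H ∧ S.pos (j + 1) i ∈ Z) ∨ (S.pos j i ∈ Z ∧ S.pos (j + 1) i ∉ H))

open Classical in
theorem leave_le_enter {V : Type} (f : ℕ → V) (v : V) (T : ℕ) :
    ((Finset.range T).filter (fun j => f j = v ∧ f (j + 1) ≠ v)).card + (if f T = v then 1 else 0)
      ≤ ((Finset.range T).filter (fun j => f j ≠ v ∧ f (j + 1) = v)).card + 1 := by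
  induction T with
  | zero => simp; split_ifs <;> omega
  | succ n ih =>
    rw [Finset.range_add_one, Finset.filter_insert, Finset.filter_insert]
    by_cases h1 : f n = v <;> by_cases h2 : f (n + 1) = v <;> simp [h1, h2] at ih ⊢ <;> omega

/-- There is a universal constant `c > 0` such that: for every GCMP
instance with `k` robots, every `p`-boundaried subgraph `(H, Z)` whose boundary contains
all terminals, and every schedule `S` in which each vertex is entered by any robot at
most `ν` times, the number of checkpoints of `S` with respect to `(H, Z)` is at most
`c * p * k * ν`. -/
theorem checkpoint_count_bound :
    ∃ c : ℕ, 0 < c ∧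
      ∀ (V : Type) (G : SimpleGraph V) (k : ℕ) (I : Inst V G k) (H Z : Set V) (p : ℕ),
        IsBoundaried G H Z p →
        (∀ i : Fin k, I.start i ∈ Z) →
        (∀ i : Fin k, I.isM i → I.dest i ∈ Z) →
        ∀ (S : Sched I) (ν : ℕ),
          (∀ (v : V) (i : Fin k),
            {j : ℕ | j < S.T ∧ S.pos j i ≠ v ∧ S.pos (j + 1) i = v}.ncard ≤ ν) →
          {j : ℕ | j < S.T ∧ SAffects H Z S j}.ncard ≤ c * p * k * ν := by
  classical
  refine ⟨3, by norm_num, ?_⟩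
  intro V G k I H Z p hB _ _ S ν hν
  obtain ⟨hZH, hfin, hcard, _⟩ := hB
  have hE : ∀ v i, ((Finset.range S.T).filter
      (fun j => S.pos j i ≠ v ∧ S.pos (j + 1) i = v)).card ≤ ν := by
    intro v i
    refine le_trans (le_of_eq ?_) (hν v i)
    rw [← Set.ncard_coe_finset]
    congr 1
    ext j
    simp
  have hL : ∀ v i, ((Finset.range S.T).filter
      (fun j => S.pos j i = v ∧ S.pos (j + 1) i ≠ v)).card ≤ 2 * ν := by
    intro v i
    rcases Nat.eq_zero_or_pos ν with h0 | h0
    · subst h0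
      rw [Nat.mul_zero, Nat.le_zero, Finset.card_eq_zero, Finset.eq_empty_iff_forall_notMem]
      intro j hj
      rw [Finset.mem_filter] at hj
      have h := hE (S.pos (j + 1) i) i
      rw [Nat.le_zero, Finset.card_eq_zero, Finset.eq_empty_iff_forall_notMem] at h
      apply h j
      rw [Finset.mem_filter]
      refine ⟨hj.1, ?_, rfl⟩
      rw [hj.2.1]
      exact fun e => hj.2.2 e.symm
    · have h := leave_le_enter (fun j => S.pos j i) v S.T
      have h2 := hE v i
      omega
  let A : Fin k × V → Finset ℕ := fun q =>
    (Finset.range S.T).filter (fun j => S.pos j q.1 ≠ q.2 ∧ S.pos (j + 1) q.1 = q.2) ∪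
    (Finset.range S.T).filter (fun j => S.pos j q.1 = q.2 ∧ S.pos (j + 1) q.1 ≠ q.2)
  let Q : Finset (Fin k × V) := Finset.univ ×ˢ hfin.toFinset
  have hsub : {j : ℕ | j < S.T ∧ SAffects H Z S j} ⊆ ((Q.biUnion A : Finset ℕ) : Set ℕ) := by
    rintro j ⟨hj, i, hne, h⟩
    rw [Finset.mem_coe, Finset.mem_biUnion]
    have h' : S.pos (j + 1) i ∈ Z ∨ S.pos j i ∈ Z := by tauto
    rcases h' with h' | h'
    · exact ⟨(i, S.pos (j + 1) i), by simp [Q, h'], by simp [A, hj, hne]⟩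
    · exact ⟨(i, S.pos j i), by simp [Q, h'], by simp [A, hj, Ne.symm hne]⟩
  have h1 := Set.ncard_le_ncard hsub (Finset.finite_toSet _)
  rw [Set.ncard_coe_finset] at h1
  have h2 : (Q.biUnion A).card ≤ Q.card * (3 * ν) := by
    apply Finset.card_biUnion_le_card_mul
    intro q _
    refine (Finset.card_union_le _ _).trans ?_
    have a := hE q.2 q.1
    have b := hL q.2 q.1
    omega
  have h3 : Q.card = k * Z.ncard := by
    simp [Q, Finset.card_product, Set.ncard_eq_toFinset_card Z hfin]
  calc _ ≤ Q.card * (3 * ν) := h1.trans h2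
    _ ≤ (k * p) * (3 * ν) := by rw [h3]; gcongr
    _ = 3 * p * k * ν := by ring
end

section
/- Let I be a GCMP instance with k robots and let (H,Z) be a p-boundaried subgraph of G whose boundary Z contains all terminals. There is a universal constant c > 0 such that the number of possible checkpoint tuple sequences, ranging over all schedules S for I in which each vertex is entered by any robot at most ν(k) times, is at most (p+2)^{c·p·k²·ν(k)} (equivalently, p^{O(p·k·ν(k))} for fixed k). -/
open SimpleGraph

open Classical in
/-- The signature of schedule `S` with respect to `(H, Z)` at time `j`: the `i`-th
coordinate is the boundary vertex occupied by robot `i`, or `inside` (`↓`) if robot `i`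
is in `H \ Z`, or `outside` (`↑`) if it is outside `H`. -/
noncomputable def sigS {V : Type} {G : SimpleGraph V} {k : ℕ} {I : Inst V G k}
    (H Z : Set V) (S : Sched I) (j : ℕ) : Fin k → BStatus V := fun i =>
  if S.pos j i ∈ Z then BStatus.atZ (S.pos j i)
  else if S.pos j i ∈ H then BStatus.inside
  else BStatus.outside

/-- Time step `j` participates in a checkpoint of `S` with respect to `(H, Z)`. -/
def ParticipatesS {V : Type} {G : SimpleGraph V} {k : ℕ} {I : Inst V G k}
    (H Z : Set V) (S : Sched I) (j : ℕ) : Prop :=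
  (j < S.T ∧ SAffects H Z S j) ∨ (0 < j ∧ j - 1 < S.T ∧ SAffects H Z S (j - 1))

open Classical in
/-- The checkpoint tuple sequence of `S` with respect to `(H, Z)`: the signature tuples
at the time steps participating in checkpoints, ordered by time step. -/
noncomputable def ctseq {V : Type} {G : SimpleGraph V} {k : ℕ} {I : Inst V G k}
    (H Z : Set V) (S : Sched I) : List (Fin k → BStatus V) :=
  ((List.range (S.T + 1)).filter fun j => decide (ParticipatesS H Z S j)).map
    fun j => sigS H Z S j

open Classical in
theorem exits_le (P : ℕ → Prop) (T : ℕ) :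
    ((Finset.range T).filter fun j => P j ∧ ¬ P (j+1)).card + (if P T then 1 else 0)
      = ((Finset.range T).filter fun j => ¬ P j ∧ P (j+1)).card + (if P 0 then 1 else 0) := by
  induction T with
  | zero => simp
  | succ n ih =>
    rw [Finset.range_add_one, Finset.filter_insert, Finset.filter_insert]
    by_cases h1 : P n <;> by_cases h2 : P (n+1) <;> simp [h1, h2] at ih ⊢ <;> omega

open Classical in
theorem checkpoints_card {V : Type} {G : SimpleGraph V} {k : ℕ} {I : Inst V G k}
    (H Z : Set V) (p : ℕ) (hf : Z.Finite) (hc : Z.ncard ≤ p) (ν : ℕ) (S : Sched I)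
    (hS : ∀ (v : V) (i : Fin k),
      {j : ℕ | j < S.T ∧ S.pos j i ≠ v ∧ S.pos (j + 1) i = v}.ncard ≤ ν) :
    ((Finset.range S.T).filter fun j => SAffects H Z S j).card ≤ 3 * p * k * ν := by
  have hE : ∀ (v : V) (i : Fin k),
      ((Finset.range S.T).filter fun j => ¬ S.pos j i = v ∧ S.pos (j+1) i = v).card ≤ ν := by
    intro v i
    refine le_trans (le_of_eq ?_) (hS v i)
    rw [← Set.ncard_coe_finset]
    congr 1
    ext j
    simp
  rcases Nat.eq_zero_or_pos ν with rfl | hν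
  · simp only [mul_zero, Nat.le_zero, Finset.card_eq_zero]
    refine Finset.filter_eq_empty_iff.2 ?_
    rintro j hj ⟨i, hne, -⟩
    have := hE (S.pos (j+1) i) i
    simp only [Nat.le_zero, Finset.card_eq_zero] at this
    exact Finset.filter_eq_empty_iff.1 this hj ⟨hne, rfl⟩
  have hX : ∀ (v : V) (i : Fin k),
      ((Finset.range S.T).filter fun j => S.pos j i = v ∧ ¬ S.pos (j+1) i = v).card ≤ ν + 1 := by
    intro v i
    have h1 := exits_le (fun j => S.pos j i = v) S.T
    have h2 := hE v i
    have h3 : (if S.pos 0 i = v then 1 else 0) ≤ 1 := by split_ifs <;> simp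
    omega
  have hsub : ((Finset.range S.T).filter fun j => SAffects H Z S j) ⊆
      (hf.toFinset ×ˢ (Finset.univ : Finset (Fin k))).biUnion fun q =>
        ((Finset.range S.T).filter fun j => ¬ S.pos j q.2 = q.1 ∧ S.pos (j+1) q.2 = q.1) ∪
        ((Finset.range S.T).filter fun j => S.pos j q.2 = q.1 ∧ ¬ S.pos (j+1) q.2 = q.1) := by
    intro j hj
    rw [Finset.mem_filter] at hj
    obtain ⟨hj, i, hne, h⟩ := hj
    have h' : S.pos (j+1) i ∈ Z ∨ S.pos j i ∈ Z := by tauto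
    simp only [Finset.mem_biUnion, Finset.mem_product, Set.Finite.mem_toFinset, Finset.mem_univ,
      and_true, Finset.mem_union, Finset.mem_filter]
    rcases h' with h' | h'
    · exact ⟨(S.pos (j+1) i, i), h', Or.inl ⟨hj, hne, rfl⟩⟩
    · exact ⟨(S.pos j i, i), h', Or.inr ⟨hj, rfl, fun e => hne e.symm⟩⟩
  have hcard : (hf.toFinset ×ˢ (Finset.univ : Finset (Fin k))).card ≤ p * k := by
    rw [Finset.card_product, Finset.card_univ, Fintype.card_fin]
    rw [Set.ncard_eq_toFinset_card Z hf] at hc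
    exact Nat.mul_le_mul_right _ hc
  calc _ ≤ _ := Finset.card_le_card hsub
    _ ≤ (hf.toFinset ×ˢ (Finset.univ : Finset (Fin k))).card * (3 * ν) := by
        refine Finset.card_biUnion_le_card_mul _ _ _ ?_
        intro q _
        refine (Finset.card_union_le _ _).trans ?_
        have := hE q.1 q.2
        have := hX q.1 q.2
        omega
    _ ≤ (p * k) * (3 * ν) := Nat.mul_le_mul_right _ hcard
    _ = 3 * p * k * ν := by ring

open Classical in
theorem ctseq_length {V : Type} {G : SimpleGraph V} {k : ℕ} {I : Inst V G k}
    (H Z : Set V) (S : Sched I) :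
    (ctseq H Z S).length ≤ 2 * ((Finset.range S.T).filter fun j => SAffects H Z S j).card := by
  unfold ctseq
  rw [List.length_map, ← List.toFinset_card_of_nodup (List.nodup_range.filter _)]
  set C := (Finset.range S.T).filter fun j => SAffects H Z S j with hC
  have : (List.filter (fun j => decide (ParticipatesS H Z S j)) (List.range (S.T+1))).toFinset
      ⊆ C ∪ C.image Nat.succ := by
    intro j hj
    simp only [List.mem_toFinset, List.mem_filter, decide_eq_true_eq] at hj
    rw [Finset.mem_union, Finset.mem_image]
    rcases hj.2 with h | h
    · left; simpa [hC] using h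
    · right
      exact ⟨j - 1, by simpa [hC] using h.2, by have := h.1; omega⟩
  have h1 := Finset.card_le_card this
  have h2 := Finset.card_union_le C (C.image Nat.succ)
  have h3 := Finset.card_image_le (s := C) (f := Nat.succ)
  omega

def decodeB {V : Type} {Z : Set V} : Option (Option Z) → BStatus V
  | none => BStatus.inside
  | some none => BStatus.outside
  | some (some v) => BStatus.atZ v.1

def decodeL {V : Type} {Z : Set V} {k N : ℕ}
    (f : Fin N → Option (Fin k → Option (Option Z))) : List (Fin k → BStatus V) :=
  (List.ofFn f).reduceOption.map fun g i => decodeB (g i)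

theorem list_pad {α : Type} (l : List α) (N : ℕ) (h : l.length ≤ N) :
    ∃ f : Fin N → Option α, (List.ofFn f).reduceOption = l := by
  obtain ⟨m, hm, hr⟩ : ∃ m : List (Option α), m.length = N ∧ m.reduceOption = l := by
    refine ⟨l.map some ++ List.replicate (N - l.length) none, by simp; omega, ?_⟩
    rw [List.reduceOption_append, List.reduceOption_replicate_none]
    simp [List.reduceOption]
  subst hm
  exact ⟨m.get, by rw [List.ofFn_get]; exact hr⟩

theorem sigS_decode {V : Type} {G : SimpleGraph V} {k : ℕ} {I : Inst V G k}
    (H Z : Set V) (S : Sched I) (j : ℕ) :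
    ∃ g : Fin k → Option (Option Z), (fun i => decodeB (g i)) = sigS H Z S j := by
  have : ∀ i, ∃ o : Option (Option Z), decodeB o = sigS H Z S j i := by
    intro i
    unfold sigS
    split_ifs with h1 h2
    · exact ⟨some (some ⟨_, h1⟩), rfl⟩
    · exact ⟨none, rfl⟩
    · exact ⟨some none, rfl⟩
  choose g hg using this
  exact ⟨g, funext hg⟩

/-- There is a universal constant `c > 0` such that: for every GCMP
instance with `k` robots and every `p`-boundaried subgraph `(H, Z)` whose boundary
contains all terminals, the number of possible checkpoint tuple sequences, ranging over
all schedules in which each vertex is entered by any robot at most `ν` times, is at most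
`(p + 2) ^ (c * p * k ^ 2 * ν)`. -/
theorem checkpoint_sequences_bound :
    ∃ c : ℕ, 0 < c ∧
      ∀ (V : Type) (G : SimpleGraph V) (k : ℕ) (I : Inst V G k) (H Z : Set V) (p : ℕ),
        IsBoundaried G H Z p →
        (∀ i : Fin k, I.start i ∈ Z) →
        (∀ i : Fin k, I.isM i → I.dest i ∈ Z) →
        ∀ ν : ℕ,
          {L : List (Fin k → BStatus V) | ∃ S : Sched I,
              (∀ (v : V) (i : Fin k),
                {j : ℕ | j < S.T ∧ S.pos j i ≠ v ∧ S.pos (j + 1) i = v}.ncard ≤ ν) ∧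
              L = ctseq H Z S}.ncard
            ≤ (p + 2) ^ (c * p * k ^ 2 * ν) := by
  refine ⟨12, by norm_num, ?_⟩
  intro V G k I H Z p hB _ _ ν
  obtain ⟨-, hf, hc, -⟩ := hB
  haveI : Fintype Z := hf.fintype
  have hZ : Fintype.card Z ≤ p := by
    rw [← Nat.card_eq_fintype_card]; exact hc
  set N := 6 * p * k * ν with hN
  have hsub : {L : List (Fin k → BStatus V) | ∃ S : Sched I,
      (∀ (v : V) (i : Fin k),
        {j : ℕ | j < S.T ∧ S.pos j i ≠ v ∧ S.pos (j + 1) i = v}.ncard ≤ ν) ∧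
      L = ctseq H Z S} ⊆ Set.range (decodeL (Z := Z) (k := k) (N := N)) := by
    rintro L ⟨S, hS, rfl⟩
    have hlen : (ctseq H Z S).length ≤ N := by
      have h1 := ctseq_length H Z S
      have h2 := checkpoints_card H Z p hf hc ν S hS
      have h3 : N = 2 * (3 * p * k * ν) := by rw [hN]; ring
      omega
    choose g hg using sigS_decode H Z S
    unfold ctseq at hlen ⊢
    rw [List.length_map] at hlen
    obtain ⟨f, hf'⟩ := list_pad (List.map g _) N (by rw [List.length_map]; exact hlen)
    refine ⟨f, ?_⟩
    unfold decodeL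
    rw [hf', List.map_map]
    exact List.map_congr_left fun j _ => hg j
  classical
  have hcard : (Set.range (decodeL (Z := Z) (k := k) (N := N))).ncard
      ≤ (((Fintype.card Z + 2) ^ k) + 1) ^ N := by
    rw [← Set.image_univ]
    refine (Set.ncard_image_le Set.finite_univ).trans ?_
    rw [Set.ncard_univ, Nat.card_eq_fintype_card]
    simp
  refine (Set.ncard_le_ncard hsub (Set.finite_range _)).trans (hcard.trans ?_)
  rcases Nat.eq_zero_or_pos k with rfl | hk
  · simp [hN]
  have hA : (Fintype.card Z + 2) ^ k ≤ (p + 2) ^ k := Nat.pow_le_pow_left (by omega) k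
  have hA2 : 2 ≤ (p + 2) ^ k :=
    le_trans (by omega : 2 ≤ p + 2) (Nat.le_self_pow (by omega) _)
  calc _ ≤ (((p + 2) ^ k) ^ 2) ^ N := Nat.pow_le_pow_left (by nlinarith) N
    _ = (p + 2) ^ (12 * p * k ^ 2 * ν) := by
      rw [← pow_mul, ← pow_mul, hN]; congr 1; ring
end

section
/- Let I be a GCMP instance, let S be a schedule for I of minimum total traveled length, let M' ⊆ M be the set of robots whose destination differs from their starting vertex, and let U be the set of starting vertices of the robots in M'. Let E_S be the set of edges of G that appear in some route of S (an edge appears in a route (u_0,...,u_t) if its endpoints are u_{j-1} and u_j for some j with u_{j-1} ≠ u_j). Then every connected component of the subgraph of G induced by E_S contains a vertex of U; moreover, |E_S| is at most the total traveled length ℓ of S, and consequently every vertex occupied at any time step by a robot that moves in S lies within distance ℓ in G of some vertex of U. -/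
open SimpleGraph

/-- The set of edges of `G` appearing in some route of `S`. -/
def appearingEdges {V : Type} {G : SimpleGraph V} {k : ℕ} {I : Inst V G k}
    (S : Sched I) : Set (Sym2 V) :=
  {e : Sym2 V | ∃ u v : V, e = s(u, v) ∧ u ≠ v ∧
    ∃ (i : Fin k) (j : ℕ), j < S.T ∧ S.pos j i = u ∧ S.pos (j + 1) i = v}

lemma aux_reach {V : Type} {G : SimpleGraph V} {k : ℕ} {I : Inst V G k}
    (S : Sched I) (i : Fin k) : ∀ j, j ≤ S.T →
    (SimpleGraph.fromEdgeSet (appearingEdges S)).Reachable (I.start i) (S.pos j i) := by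
  intro j
  induction j with
  | zero => intro _; rw [S.init]
  | succ j ih =>
    intro hj
    refine (ih (by omega)).trans ?_
    by_cases h : S.pos j i = S.pos (j + 1) i
    · rw [h]
    · apply SimpleGraph.Adj.reachable
      rw [SimpleGraph.fromEdgeSet_adj]
      exact ⟨⟨_, _, rfl, h, i, j, by omega, rfl, rfl⟩, h⟩

lemma aux_eq {V : Type} {G : SimpleGraph V} {k : ℕ} {I : Inst V G k}
    (S : Sched I) : appearingEdges S = ⋃ i : Fin k,
      (fun j => s(S.pos j i, S.pos (j + 1) i)) ''
        {j : ℕ | j < S.T ∧ S.pos j i ≠ S.pos (j + 1) i} := by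
  ext e
  simp only [appearingEdges, Set.mem_setOf_eq, Set.mem_iUnion, Set.mem_image]
  constructor
  · rintro ⟨u, v, rfl, huv, i, j, hj, rfl, rfl⟩
    exact ⟨i, j, ⟨hj, huv⟩, rfl⟩
  · rintro ⟨i, j, ⟨hj, huv⟩, rfl⟩
    exact ⟨_, _, rfl, huv, i, j, hj, rfl, rfl⟩

lemma aux_fin {V : Type} {G : SimpleGraph V} {k : ℕ} {I : Inst V G k}
    (S : Sched I) (i : Fin k) :
    {j : ℕ | j < S.T ∧ S.pos j i ≠ S.pos (j + 1) i}.Finite :=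
  (Set.finite_lt_nat S.T).subset fun _ h => h.1

lemma aux_finE {V : Type} {G : SimpleGraph V} {k : ℕ} {I : Inst V G k}
    (S : Sched I) : (appearingEdges S).Finite := by
  rw [aux_eq]
  exact Set.finite_iUnion fun i => (aux_fin S i).image _

lemma aux_card {V : Type} {G : SimpleGraph V} {k : ℕ} {I : Inst V G k}
    (S : Sched I) : (appearingEdges S).ncard ≤ totalLength S := by
  rw [aux_eq]
  refine (Set.ncard_iUnion_le_of_fintype _).trans ?_
  exact Finset.sum_le_sum fun i _ => Set.ncard_image_le (aux_fin S i)

lemma aux_le {V : Type} {G : SimpleGraph V} {k : ℕ} {I : Inst V G k}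
    (S : Sched I) : SimpleGraph.fromEdgeSet (appearingEdges S) ≤ G := by
  intro a b h
  rw [SimpleGraph.fromEdgeSet_adj] at h
  obtain ⟨⟨u, v, e, huv, i, j, hj, rfl, rfl⟩, hab⟩ := h
  have h := (S.step j hj i).resolve_left (Ne.symm huv)
  rcases Sym2.eq_iff.1 e with ⟨rfl, rfl⟩ | ⟨rfl, rfl⟩
  · exact h
  · exact h.symm

lemma aux_dist {V : Type} {G : SimpleGraph V} {k : ℕ} {I : Inst V G k}
    (S : Sched I) {a b : V}
    (h : (SimpleGraph.fromEdgeSet (appearingEdges S)).Reachable a b) :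
    G.dist a b ≤ totalLength S := by
  classical
  obtain ⟨p, hp⟩ := h.exists_isPath
  have h1 : G.dist a b ≤ p.length := by
    have := SimpleGraph.dist_le (p.mapLe (aux_le S))
    simpa using this
  refine h1.trans (le_trans ?_ (aux_card S))
  rw [← SimpleGraph.Walk.length_edges, ← List.toFinset_card_of_nodup hp.isTrail.edges_nodup,
    ← Set.ncard_coe_finset]
  apply Set.ncard_le_ncard _ (aux_finE S)
  intro e he
  have := p.edges_subset_edgeSet (by simpa using he)
  rw [SimpleGraph.edgeSet_fromEdgeSet] at this
  exact this.1

open Classical in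
noncomputable def frozen {V : Type} {G : SimpleGraph V} {k : ℕ} {I : Inst V G k}
    (S : Sched I) (v : V)
    (hv : ∀ i, I.isM i → (SimpleGraph.fromEdgeSet (appearingEdges S)).Reachable v (I.start i) →
      I.start i = I.dest i) : Sched I where
  T := S.T
  pos j i := if (SimpleGraph.fromEdgeSet (appearingEdges S)).Reachable v (I.start i)
    then I.start i else S.pos j i
  init i := by split_ifs <;> simp [S.init]
  final i hi := by
    split_ifs with h
    · exact hv i hi h
    · exact S.final i hi
  step j hj i := by
    split_ifs with h
    · exact Or.inl rfl
    · exact S.step j hj i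
  noVertexConflict j hj := by
    intro a b hab
    have ha := aux_reach S a j hj
    have hb := aux_reach S b j hj
    dsimp only at hab
    split_ifs at hab with h1 h2 h2
    · exact I.start_inj hab
    · rw [← hab] at hb
      exact absurd (h1.trans hb.symm) h2
    · rw [hab] at ha
      exact absurd (h2.trans ha.symm) h1
    · exact S.noVertexConflict j hj hab
  noSwap j hj a b hab := by
    have ha := aux_reach S a j hj.le
    have hb := aux_reach S b j hj.le
    rintro ⟨e1, e2⟩
    split_ifs at e1 e2 with h1 h2 h2
    · exact hab (I.start_inj e1)
    · rw [← e1] at hb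
      exact absurd (h1.trans hb.symm) h2
    · rw [← e2] at ha
      exact absurd (h2.trans ha.symm) h1
    · exact S.noSwap j hj a b hab ⟨e1, e2⟩

lemma aux_comp {V : Type} {G : SimpleGraph V} {k : ℕ}
    (I : Inst V G k) (S : Sched I) (hopt : Optimal S) (v : V)
    (hv : ∃ e ∈ appearingEdges S, v ∈ e) :
      ∃ i : Fin k, I.isM i ∧ I.start i ≠ I.dest i ∧
        (SimpleGraph.fromEdgeSet (appearingEdges S)).Reachable v (I.start i) := by
  by_contra hcon
  have hc : ∀ i, I.isM i →
      (SimpleGraph.fromEdgeSet (appearingEdges S)).Reachable v (I.start i) →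
      I.start i = I.dest i := by
    intro i hi hr
    by_contra hne
    exact hcon ⟨i, hi, hne, hr⟩
  obtain ⟨e, ⟨x, y, rfl, hxy, i, j, hj, rfl, rfl⟩, hve⟩ := hv
  have hri : (SimpleGraph.fromEdgeSet (appearingEdges S)).Reachable v (I.start i) := by
    rcases Sym2.mem_iff.1 hve with rfl | rfl
    · exact (aux_reach S i j hj.le).symm
    · exact (aux_reach S i (j + 1) hj).symm
  refine absurd (hopt (frozen S v hc)) (not_le.2 ?_)
  refine Finset.sum_lt_sum (fun a _ => ?_) ⟨i, Finset.mem_univ _, ?_⟩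
  · apply Set.ncard_le_ncard _ (aux_fin S a)
    rintro t ⟨ht, hne⟩
    refine ⟨ht, ?_⟩
    simp only [frozen] at hne
    split_ifs at hne with h
    · exact absurd rfl hne
    · exact hne
  · have h0 : routeLength (frozen S v hc) i = 0 := by
      simp [routeLength, frozen, hri]
    rw [h0]
    exact (Set.ncard_pos (aux_fin S i)).2 ⟨j, hj, hxy⟩

/-- Let `S` be an optimal schedule for a GCMP instance, let `M'` be the
set of robots of `M` whose destination differs from their start and `U` the set of their
starting vertices, and let `E_S` be the set of edges appearing in `S`. Then every
connected component of the subgraph induced by `E_S` contains a vertex of `U`; moreover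
`|E_S|` is at most the total traveled length `ℓ` of `S`, and every vertex occupied at any
time step by a robot that moves in `S` lies within distance `ℓ` in `G` of some vertex
of `U`. -/
theorem optimal_schedule_components {V : Type} {G : SimpleGraph V} {k : ℕ}
    (I : Inst V G k) (S : Sched I) (hopt : Optimal S) :
    -- every connected component of the subgraph induced by `E_S` contains a vertex of
    -- `U = start '' M'`
    (∀ v : V, (∃ e ∈ appearingEdges S, v ∈ e) →
      ∃ i : Fin k, I.isM i ∧ I.start i ≠ I.dest i ∧
        (SimpleGraph.fromEdgeSet (appearingEdges S)).Reachable v (I.start i)) ∧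
    -- |E_S| ≤ ℓ
    (appearingEdges S).ncard ≤ totalLength S ∧
    -- every vertex occupied by a moving robot is within distance ℓ of U
    (∀ i : Fin k, (∃ j, j < S.T ∧ S.pos j i ≠ S.pos (j + 1) i) →
      ∀ j, j ≤ S.T →
        ∃ i' : Fin k, I.isM i' ∧ I.start i' ≠ I.dest i' ∧
          G.Reachable (S.pos j i) (I.start i') ∧
          G.dist (S.pos j i) (I.start i') ≤ totalLength S) := by
  refine ⟨aux_comp I S hopt, aux_card S, ?_⟩
  rintro i ⟨j0, hj0, hne⟩ j hj
  obtain ⟨i', hM, hd, hr⟩ := aux_comp I S hopt (S.pos j0 i)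
    ⟨s(S.pos j0 i, S.pos (j0 + 1) i), ⟨_, _, rfl, hne, i, j0, hj0, rfl, rfl⟩, by simp⟩
  have h := ((aux_reach S i j hj).symm.trans (aux_reach S i j0 hj0.le)).trans hr
  exact ⟨i', hM, hd, h.mono (aux_le S), aux_dist S h⟩
end
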